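/- Let N be a high-level Petri net in the class Nf, let ≺ be an adequate order on the finite configurations of its symbolic unfolding Υ, and let Fin be the prefix of Υ consisting of all events e such that the cone [e] contains no cut-off event of Υ other than possibly e itself, together with all conditions in B0 and in the postsets of these events. Then Fin is a complete prefix of Υ. -/

import Mathlib

/-
Core formalization of high-level Petri nets, symbolic unfoldings,
branching processes, configurations, adequate orders, cut-off events,
expansions and constraints, following Würdemann–Chatain–Haar–Panneke,
"Taking Complete Finite Prefixes To High Level, Symbolically".
-/

noncomputable section
open scoped Classical

/-- A high-level Petri net over a set `Color` of colors and a set `Var` of variables: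
places, transitions, a flow function (given by the multisets of `(place, variable)`
pairs on the input resp. output arcs of each transition), a guard for each transition
(a predicate on the assignments of colors to variables), and a set of initial markings. -/
structure HLNet (Color : Type) (Var : Type) : Type 1 where
  Place : Type
  Trans : Type
  preFlow : Trans → Multiset (Place × Var)
  postFlow : Trans → Multiset (Place × Var)
  guard : Trans → (Var → Color) → Prop
  init : Set (Multiset (Place × Color))

namespace HLNet

variable {Color Var : Type}

/-- A marking: a multiset over `Place × Color`. -/
abbrev Marking (N : HLNet Color Var) : Type := Multiset (N.Place × Color)

/-- Well-formedness: the set of initial markings is nonempty, and all initial markings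
mark the same places with the same numbers of colors. -/
def WellFormed (N : HLNet Color Var) : Prop :=
  N.init.Nonempty ∧
    ∀ M ∈ N.init, ∀ M' ∈ N.init, Multiset.map Prod.fst M = Multiset.map Prod.fst M'

/-- The net is finite: finitely many places and transitions
(the support of the flow function is then automatically finite). -/
def NetFinite (N : HLNet Color Var) : Prop := Finite N.Place ∧ Finite N.Trans

/-- The guards are written in a decidable theory (stand-in: each guard is a
decidable predicate on modes). -/
def DecidableGuards (N : HLNet Color Var) : Prop :=
  ∀ t σ, Nonempty (Decidable (N.guard t σ))

/-- `•(t,σ)`, the multiset of colored tokens consumed by transition `t` fired in mode `σ`. -/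
def preMark (N : HLNet Color Var) (t : N.Trans) (σ : Var → Color) : N.Marking :=
  (N.preFlow t).map fun pv => (pv.1, σ pv.2)

/-- `(t,σ)•`, the multiset of colored tokens produced by transition `t` fired in mode `σ`. -/
def postMark (N : HLNet Color Var) (t : N.Trans) (σ : Var → Color) : N.Marking :=
  (N.postFlow t).map fun pv => (pv.1, σ pv.2)

/-- `M[t,σ⟩`: transition `t` can fire in mode `σ` from marking `M`
(`σ` is a mode of `t`, i.e. the guard holds, and `•(t,σ) ≤ M`). -/
def fires (N : HLNet Color Var) (M : N.Marking) (t : N.Trans) (σ : Var → Color) : Prop :=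
  N.guard t σ ∧ N.preMark t σ ≤ M

/-- `M[t,σ⟩M'`: firing `t` in mode `σ` from `M` yields `M'`. -/
def firesTo (N : HLNet Color Var) (M : N.Marking) (t : N.Trans) (σ : Var → Color)
    (M' : N.Marking) : Prop :=
  N.fires M t σ ∧ M' = (M - N.preMark t σ) + N.postMark t σ

/-- `R(N)`: the markings reachable from some initial marking by finitely many firings. -/
inductive Reach (N : HLNet Color Var) : N.Marking → Prop
  | init {M : N.Marking} : M ∈ N.init → Reach N M
  | step {M : N.Marking} {t : N.Trans} {σ : Var → Color} {M' : N.Marking} :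
      Reach N M → N.firesTo M t σ M' → Reach N M'

/-- The markings reachable in exactly `n` firings. -/
def ReachSteps (N : HLNet Color Var) : ℕ → N.Marking → Prop
  | 0, M => M ∈ N.init
  | n + 1, M' => ∃ M t σ, ReachSteps N n M ∧ N.firesTo M t σ M'

/-- Every reachable marking is reachable by firing at most `n` transitions. -/
def BoundedReach (N : HLNet Color Var) (n : ℕ) : Prop :=
  ∀ M, N.Reach M → ∃ k ≤ n, N.ReachSteps k M

/-- Safety: in every reachable marking every place holds at most one color. -/
def Safe (N : HLNet Color Var) : Prop :=
  ∀ M, N.Reach M → ∀ p : N.Place, (M.filter fun pc => pc.1 = p).card ≤ 1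

/-- Nodes of the net: places and transitions. -/
abbrev Node (N : HLNet Color Var) : Type := N.Place ⊕ N.Trans

/-- The arc relation `x → y` between nodes. -/
def arc (N : HLNet Color Var) : N.Node → N.Node → Prop
  | Sum.inl b, Sum.inr t => ∃ v, (b, v) ∈ N.preFlow t
  | Sum.inr t, Sum.inl b => ∃ v, (b, v) ∈ N.postFlow t
  | Sum.inl _, Sum.inl _ => False
  | Sum.inr _, Sum.inr _ => False

/-- The causality relation `<` (irreflexive transitive closure of the arc relation). -/
def clt (N : HLNet Color Var) : N.Node → N.Node → Prop := Relation.TransGen N.arc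

/-- The causality relation `≤` (reflexive transitive closure of the arc relation). -/
def cle (N : HLNet Color Var) : N.Node → N.Node → Prop := Relation.ReflTransGen N.arc

/-- `<` on transitions/events. -/
def evLT (N : HLNet Color Var) (e e' : N.Trans) : Prop := N.clt (Sum.inr e) (Sum.inr e')

/-- `≤` on transitions/events. -/
def evLE (N : HLNet Color Var) (e e' : N.Trans) : Prop := N.cle (Sum.inr e) (Sum.inr e')

/-- Structural conflict `x ♯ y`: distinct transitions sharing an input place
causally precede `x` and `y` respectively. -/
def SConflict (N : HLNet Color Var) (x y : N.Node) : Prop :=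
  ∃ (b : N.Place) (t1 t2 : N.Trans), t1 ≠ t2 ∧
    (∃ v, (b, v) ∈ N.preFlow t1) ∧ (∃ v, (b, v) ∈ N.preFlow t2) ∧
    N.cle (Sum.inr t1) x ∧ N.cle (Sum.inr t2) y

/-- Ordinariness: at most one arc connects any two nodes. -/
def Ordinary (N : HLNet Color Var) : Prop :=
  (∀ (t : N.Trans) (b : N.Place), ((N.preFlow t).filter fun pv => pv.1 = b).card ≤ 1) ∧
  (∀ (t : N.Trans) (b : N.Place), ((N.postFlow t).filter fun pv => pv.1 = b).card ≤ 1)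

/-- A high-level occurrence net: an ordinary well-formed high-level Petri net
(places = conditions, transitions = events) such that no event is in structural
self-conflict, no node is its own causal predecessor, causality is well-founded,
and each condition either has no incoming arc and is marked with exactly one color
in all initial cuts, or has a unique incoming arc and is unmarked in all initial cuts. -/
def IsOccNet (O : HLNet Color Var) : Prop :=
  O.WellFormed ∧ O.Ordinary ∧
  (∀ e : O.Trans, ¬ O.SConflict (Sum.inr e) (Sum.inr e)) ∧
  (∀ x : O.Node, ¬ O.clt x x) ∧
  WellFounded O.clt ∧
  (∀ b : O.Place,
    ((∀ (e : O.Trans) (v : Var), (b, v) ∉ O.postFlow e) ∧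
      ∀ K ∈ O.init, (K.filter fun bc => bc.1 = b).card = 1) ∨
    ((∃ (e : O.Trans) (v : Var), (b, v) ∈ O.postFlow e ∧
        ∀ (e' : O.Trans) (v' : Var), (b, v') ∈ O.postFlow e' → e' = e ∧ v' = v) ∧
      ∀ K ∈ O.init, (K.filter fun bc => bc.1 = b).card = 0))

/-- `•b = (e(b), v(b))`: the unique input event and arc-variable of a condition,
or `none` for the `⊥`-conditions (the conditions marked in all initial cuts). -/
def condPre (O : HLNet Color Var) (b : O.Place) : Option (O.Trans × Var) :=
  if h : ∃ ev : O.Trans × Var, (b, ev.2) ∈ O.postFlow ev.1 then some h.choose else none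

/-- An assignment of colors to the indexed variables: the variables `v_e` for events `e`
(`Sum.inl (e, v)`), and the variables `v^b_⊥` for conditions `b` (`Sum.inr b`). -/
abbrev Assign (O : HLNet Color Var) : Type := ((O.Trans × Var) ⊕ O.Place) → Color

/-- The color placed on condition `b` under assignment `ι`:
the value of `v(b)_{e(b)}`, resp. `v^b_⊥`. -/
def valOf (O : HLNet Color Var) (ι : O.Assign) (b : O.Place) : Color :=
  match O.condPre b with
  | none => ι (Sum.inr b)
  | some ev => ι (Sum.inl ev)

/-- `pred(⊥)`: `ι` chooses one of the initial cuts. -/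
def predBot (O : HLNet Color Var) (ι : O.Assign) : Prop :=
  ∃ K ∈ O.init, ∀ (b : O.Place) (c : Color), (b, c) ∈ K → ι (Sum.inr b) = c

/-- `loc(e)`: the local predicate of an event. -/
def locPred (O : HLNet Color Var) (e : O.Trans) (ι : O.Assign) : Prop :=
  O.guard e (fun v => ι (Sum.inl (e, v))) ∧
  ∀ bv ∈ O.preFlow e, ι (Sum.inl (e, bv.2)) = O.valOf ι bv.1

/-- `pred(e) = pred(⊥) ∧ ⋀_{e' ≤ e} loc(e')`. -/
def pred (O : HLNet Color Var) (e : O.Trans) (ι : O.Assign) : Prop :=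
  O.predBot ι ∧ ∀ e', O.evLE e' e → O.locPred e' ι

/-- `pred(e(b))` for a condition `b` (which is `pred(⊥)` for `⊥`-conditions). -/
def condPred (O : HLNet Color Var) (b : O.Place) (ι : O.Assign) : Prop :=
  match O.condPre b with
  | none => O.predBot ι
  | some ev => O.pred ev.1 ι

/-- An instantiation of a set `C` of events: an assignment satisfying `pred(e)` for
every `e ∈ C ∪ {⊥}`. -/
def IsInst (O : HLNet Color Var) (C : Set O.Trans) (ι : O.Assign) : Prop :=
  O.predBot ι ∧ ∀ e ∈ C, O.pred e ι

/-- A configuration: a causally closed set of events free of structural conflict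
and of color conflict. -/
def IsConfig (O : HLNet Color Var) (C : Set O.Trans) : Prop :=
  (∀ e ∈ C, ∀ e', O.evLE e' e → e' ∈ C) ∧
  (∀ e ∈ C, ∀ e' ∈ C, ¬ O.SConflict (Sum.inr e) (Sum.inr e')) ∧
  ∃ ι, O.IsInst C ι

/-- A finite configuration. -/
def FinCfg (O : HLNet Color Var) (C : Set O.Trans) : Prop := O.IsConfig C ∧ C.Finite

/-- The cone configuration `[e] = {e' : e' ≤ e}` of an event. -/
def cone (O : HLNet Color Var) (e : O.Trans) : Set O.Trans := {e' | O.evLE e' e}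

/-- `B0`: the conditions marked in all initial cuts (those with `•b = (⊥, v^b)`). -/
def B0 (O : HLNet Color Var) : Set O.Place := {b | O.condPre b = none}

/-- `C→`: the conditions in the postsets of the events of `C`. -/
def postConds (O : HLNet Color Var) (C : Set O.Trans) : Set O.Place :=
  {b | ∃ e ∈ C, ∃ v, (b, v) ∈ O.postFlow e}

/-- `→C`: the conditions in the presets of the events of `C`. -/
def preConds (O : HLNet Color Var) (C : Set O.Trans) : Set O.Place :=
  {b | ∃ e ∈ C, ∃ v, (b, v) ∈ O.preFlow e}

/-- `Cut(C) = (B0 ∪ C→) \ →C`. -/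
def cut (O : HLNet Color Var) (C : Set O.Trans) : Set O.Place :=
  (O.B0 ∪ O.postConds C) \ O.preConds C

/-- `Cut(C, ι)` as a marking of the occurrence net (requires `Cut(C)` to be finite). -/
def cutMark (O : HLNet Color Var) {C : Set O.Trans} (hfin : (O.cut C).Finite)
    (ι : O.Assign) : O.Marking :=
  hfin.toFinset.val.map fun b => (b, O.valOf ι b)

/-- `Cut(C, ι) = {(b, ι(v(b)_{e(b)})) : b ∈ Cut(C)}` as a set. -/
def cutSet (O : HLNet Color Var) (C : Set O.Trans) (ι : O.Assign) : Set (O.Place × Color) :=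
  {bc | bc.1 ∈ O.cut C ∧ bc.2 = O.valOf ι bc.1}

/-- `Cuts(C) = {Cut(C,ι) : ι ∈ I(C)}`. -/
def cuts (O : HLNet Color Var) (C : Set O.Trans) : Set (Set (O.Place × Color)) :=
  {K | ∃ ι, O.IsInst C ι ∧ K = O.cutSet C ι}

/-- `Cuts(C)` as a set of markings of the occurrence net. -/
def cutMarks (O : HLNet Color Var) (C : Set O.Trans) : Set O.Marking :=
  {K | ∃ ι, O.IsInst C ι ∧ ∃ hfin : (O.cut C).Finite, K = O.cutMark hfin ι}

/-- A homomorphism of high-level nets: maps places to places and transitions to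
transitions, preserving guards and the presets and postsets of transitions. -/
structure Hom (O N : HLNet Color Var) where
  mapP : O.Place → N.Place
  mapT : O.Trans → N.Trans
  guard_iff : ∀ (e : O.Trans) (σ : Var → Color), O.guard e σ ↔ N.guard (mapT e) σ
  pre_eq : ∀ e : O.Trans, N.preFlow (mapT e) = (O.preFlow e).map fun bv => (mapP bv.1, bv.2)
  post_eq : ∀ e : O.Trans, N.postFlow (mapT e) = (O.postFlow e).map fun bv => (mapP bv.1, bv.2)

/-- The image of a marking under a homomorphism. -/
def Hom.mapMarking {O N : HLNet Color Var} (φ : Hom O N) (M : O.Marking) : N.Marking :=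
  M.map fun bc => (φ.mapP bc.1, bc.2)

/-- An initial homomorphism: it maps the initial markings onto the initial markings. -/
def Hom.Initial {O N : HLNet Color Var} (φ : Hom O N) : Prop :=
  φ.mapMarking '' O.init = N.init

/-- `Mark(C, ι)`: the marking of `N` represented by the cut of an instantiated
configuration. -/
def mark {O N : HLNet Color Var} (h : Hom O N) {C : Set O.Trans}
    (hfin : (O.cut C).Finite) (ι : O.Assign) : N.Marking :=
  hfin.toFinset.val.map fun b => (h.mapP b, O.valOf ι b)

/-- `Marks(C) = {Mark(C,ι) : ι ∈ I(C)}`. -/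
def marks {O N : HLNet Color Var} (h : Hom O N) (C : Set O.Trans) : Set N.Marking :=
  {M | ∃ ι, O.IsInst C ι ∧ ∃ hfin : (O.cut C).Finite, M = mark h hfin ι}

/-- `(O, h)` is a symbolic branching process of `N`: `O` is an occurrence net all of
whose event predicates are satisfiable, and `h` is an initial homomorphism that is
injective on events with the same preset. -/
def IsSBP {O N : HLNet Color Var} (h : Hom O N) : Prop :=
  O.IsOccNet ∧ h.Initial ∧ (∀ e : O.Trans, ∃ ι, O.pred e ι) ∧
  ∀ e e' : O.Trans, O.preFlow e = O.preFlow e' → h.mapT e = h.mapT e' → e = e'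

/-- `(O1, h1)` is a prefix of `(O2, h2)`: there is an injective initial homomorphism
`φ : O1 → O2` with `h2 ∘ φ = h1`. -/
def IsPrefix {O1 O2 N : HLNet Color Var} (h1 : Hom O1 N) (h2 : Hom O2 N) : Prop :=
  ∃ φ : Hom O1 O2, φ.Initial ∧ Function.Injective φ.mapP ∧ Function.Injective φ.mapT ∧
    (∀ b, h2.mapP (φ.mapP b) = h1.mapP b) ∧ ∀ e, h2.mapT (φ.mapT e) = h1.mapT e

/-- `(O, h)` is the symbolic unfolding `Υ(N)` of `N`: the (unique up to isomorphism)
maximal symbolic branching process of `N`. -/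
def IsUnfolding {O N : HLNet Color Var} (h : Hom O N) : Prop :=
  IsSBP h ∧ ∀ (O' : HLNet Color Var) (h' : Hom O' N), IsSBP h' → IsPrefix h' h

/-- The net `N` with its set of initial markings replaced by `I`. -/
def withInit (N : HLNet Color Var) (I : Set N.Marking) : HLNet Color Var :=
  { N with init := I }

/-- Restriction of a marking to a subset of the places. -/
def restrictMark (O : HLNet Color Var) (SP : Set O.Place) (M : O.Marking) :
    Multiset (↥SP × Color) :=
  M.filterMap fun bc => if h : bc.1 ∈ SP then some (⟨bc.1, h⟩, bc.2) else none

/-- The subnet of `O` on the places `SP` and transitions `ST`, with initial markings `I`. -/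
def restrict (O : HLNet Color Var) (SP : Set O.Place) (ST : Set O.Trans)
    (I : Set (Multiset (↥SP × Color))) : HLNet Color Var where
  Place := ↥SP
  Trans := ↥ST
  preFlow e := (O.preFlow e.1).filterMap fun bv =>
    if h : bv.1 ∈ SP then some (⟨bv.1, h⟩, bv.2) else none
  postFlow e := (O.postFlow e.1).filterMap fun bv =>
    if h : bv.1 ∈ SP then some (⟨bv.1, h⟩, bv.2) else none
  guard e σ := O.guard e.1 σ
  init := I

/-- The predicate contributed by a node to a color conflict:
`pred(e)` for an event `e`, `pred(e(b))` for a condition `b`. -/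
def nodePred (O : HLNet Color Var) (x : O.Node) (ι : O.Assign) : Prop :=
  match x with
  | Sum.inl b => O.condPred b ι
  | Sum.inr e => O.pred e ι

/-- The nodes of the future `↑C`: nodes not in `C ∪ →C`, not in structural conflict
with any event of `C`, and not in color conflict together with `C`. -/
def futureNode (O : HLNet Color Var) (C : Set O.Trans) (x : O.Node) : Prop :=
  (match x with
   | Sum.inl b => b ∉ O.preConds C
   | Sum.inr e => e ∉ C) ∧
  (∀ e' ∈ C, ¬ O.SConflict (Sum.inr e') x) ∧
  ∃ ι, O.IsInst C ι ∧ O.nodePred x ι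

def futurePlaces (O : HLNet Color Var) (C : Set O.Trans) : Set O.Place :=
  {b | O.futureNode C (Sum.inl b)}

def futureEvents (O : HLNet Color Var) (C : Set O.Trans) : Set O.Trans :=
  {e | O.futureNode C (Sum.inr e)}

/-- The underlying net of the future `↑C` of a configuration `C`, with the cuts of `C`
as initial cuts. -/
def future (O : HLNet Color Var) (C : Set O.Trans) : HLNet Color Var :=
  O.restrict (O.futurePlaces C) (O.futureEvents C)
    (O.restrictMark (O.futurePlaces C) '' O.cutMarks C)

def futPVal (O : HLNet Color Var) (C : Set O.Trans) : (O.future C).Place → O.Place :=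
  fun b => b.1

def futTVal (O : HLNet Color Var) (C : Set O.Trans) : (O.future C).Trans → O.Trans :=
  fun e => e.1

/-- The conditions of the occurrence net `O(C|D)`: `Cut(C) ∪ →D ∪ D→`. -/
def aroundPlaces (O : HLNet Color Var) (C D : Set O.Trans) : Set O.Place :=
  O.cut C ∪ O.preConds D ∪ O.postConds D

/-- The occurrence net `O(C|D)` "around `D` from `Cut(C)`", with initial cuts `Cuts(C)`. -/
def around (O : HLNet Color Var) (C D : Set O.Trans) : HLNet Color Var :=
  O.restrict (O.aroundPlaces C D) D
    (O.restrictMark (O.aroundPlaces C D) '' O.cutMarks C)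

def arPVal (O : HLNet Color Var) (C D : Set O.Trans) : (O.around C D).Place → O.Place :=
  fun b => b.1

def arTVal (O : HLNet Color Var) (C D : Set O.Trans) : (O.around C D).Trans → O.Trans :=
  fun e => e.1

/-- `D` is a suffix of `C`, i.e. `C ⊕ D` is defined: `C` and `D` are disjoint and
`C ∪ D` is a configuration. -/
def IsSuffix (O : HLNet Color Var) (C D : Set O.Trans) : Prop :=
  Disjoint C D ∧ O.IsConfig (C ∪ D)

/-- `C⟦M⟧D`: some instantiation of `C ⊕ D`, restricted to the variables of `C ∪ {⊥}`,
yields the marking `M` for `C`. -/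
def markRel {O N : HLNet Color Var} (h : Hom O N) (C : Set O.Trans) (M : N.Marking)
    (D : Set O.Trans) : Prop :=
  ∃ ι, O.IsInst (C ∪ D) ι ∧ ∃ hfin : (O.cut C).Finite, mark h hfin ι = M

/-- `φ` is a monomorphism `O(C1|D) → ↑C2` preserving the labeling and mapping
`Cut(C1)` onto `Cut(C2)`. -/
def IsCanonMono {O N : HLNet Color Var} (h : Hom O N) (C1 D C2 : Set O.Trans)
    (φ : Hom (O.around C1 D) (O.future C2)) : Prop :=
  Function.Injective φ.mapP ∧ Function.Injective φ.mapT ∧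
  (∀ b, h.mapP (O.futPVal C2 (φ.mapP b)) = h.mapP (O.arPVal C1 D b)) ∧
  (∀ e, h.mapT (O.futTVal C2 (φ.mapT e)) = h.mapT (O.arTVal C1 D e)) ∧
  (fun b => O.futPVal C2 (φ.mapP b)) '' {b | O.arPVal C1 D b ∈ O.cut C1} = O.cut C2

/-- `φ(D)`: the image of the events `D` of `O(C1|D)` under `φ`, as a set of events of `O`. -/
def monoImageD {O : HLNet Color Var} (C1 D C2 : Set O.Trans)
    (φ : Hom (O.around C1 D) (O.future C2)) : Set O.Trans :=
  {e | ∃ d, O.futTVal C2 (φ.mapT d) = e}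

/-- An adequate order on the finite configurations of a symbolic branching process
`(O, h)`: a well-founded strict partial order refining set inclusion and preserved
by finite extensions (via the canonical monomorphism between the futures). -/
def IsAdequate {O N : HLNet Color Var} (h : Hom O N)
    (r : Set O.Trans → Set O.Trans → Prop) : Prop :=
  (∀ C, O.FinCfg C → ¬ r C C) ∧
  (∀ C1 C2 C3, O.FinCfg C1 → O.FinCfg C2 → O.FinCfg C3 → r C1 C2 → r C2 C3 → r C1 C3) ∧
  WellFounded (fun a b : {C : Set O.Trans // O.FinCfg C} => r a.1 b.1) ∧
  (∀ C1 C2, O.FinCfg C1 → O.FinCfg C2 → C1 ⊂ C2 → r C1 C2) ∧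
  (∀ C1 C2 D M, O.FinCfg C1 → O.FinCfg C2 → O.IsSuffix C1 D → D.Finite →
    M ∈ marks h C1 → M ∈ marks h C2 → markRel h C1 M D →
    ∀ φ : Hom (O.around C1 D) (O.future C2), IsCanonMono h C1 D C2 φ →
      r C1 C2 → r (C1 ∪ D) (C2 ∪ monoImageD C1 D C2 φ))

/-- A cut-off event: every marking of its cone configuration is represented
by the cone configuration of a `≺`-smaller event. -/
def IsCutoff {O N : HLNet Color Var} (h : Hom O N)
    (r : Set O.Trans → Set O.Trans → Prop) (e : O.Trans) : Prop :=
  ∀ M ∈ marks h (O.cone e), ∃ e', r (O.cone e') (O.cone e) ∧ M ∈ marks h (O.cone e')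

/-- A cut-off* event: every marking of its cone configuration is represented
by some `≺`-smaller finite configuration. -/
def IsCutoffStar {O N : HLNet Color Var} (h : Hom O N)
    (r : Set O.Trans → Set O.Trans → Prop) (e : O.Trans) : Prop :=
  ∀ M ∈ marks h (O.cone e), ∃ C, O.FinCfg C ∧ r C (O.cone e) ∧ M ∈ marks h C

/-- The events of the prefix `Fin`: events whose cone contains no cut-off event other
than possibly the event itself. -/
def finEvents {O N : HLNet Color Var} (h : Hom O N)
    (r : Set O.Trans → Set O.Trans → Prop) : Set O.Trans :=
  {e | ∀ e' ∈ O.cone e, e' ≠ e → ¬ IsCutoff h r e'}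

/-- The conditions of the prefix `Fin`: the conditions of `B0` and those in the
postsets of the events of `Fin`. -/
def finConds {O N : HLNet Color Var} (h : Hom O N)
    (r : Set O.Trans → Set O.Trans → Prop) : Set O.Place :=
  O.B0 ∪ {b | ∃ e ∈ finEvents h r, ∃ v, (b, v) ∈ O.postFlow e}

/-- The events of the prefix `Fin` for the cut-off* criterion. -/
def finEventsStar {O N : HLNet Color Var} (h : Hom O N)
    (r : Set O.Trans → Set O.Trans → Prop) : Set O.Trans :=
  {e | ∀ e' ∈ O.cone e, e' ≠ e → ¬ IsCutoffStar h r e'}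

/-- The conditions of the prefix `Fin` for the cut-off* criterion. -/
def finCondsStar {O N : HLNet Color Var} (h : Hom O N)
    (r : Set O.Trans → Set O.Trans → Prop) : Set O.Place :=
  O.B0 ∪ {b | ∃ e ∈ finEventsStar h r, ∃ v, (b, v) ∈ O.postFlow e}

/-- Completeness of the sub-branching-process of `(O,h)` on the events `E'`:
every reachable marking `M` of `N` is `Mark(C,ι)` for a configuration `C ⊆ E'` and
an instantiation `ι ∈ I(C)` such that moreover every transition/mode firable from `M`
is matched by an event of `E'` firable from `Cut(C,ι)`. -/
def CompleteSub {O N : HLNet Color Var} (h : Hom O N) (E' : Set O.Trans) : Prop :=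
  ∀ M, N.Reach M → ∃ C, O.IsConfig C ∧ C ⊆ E' ∧ ∃ ι, O.IsInst C ι ∧
    ∃ hfin : (O.cut C).Finite, M = mark h hfin ι ∧
      ∀ (t : N.Trans) (σ : Var → Color), N.fires M t σ →
        ∃ e ∈ E', h.mapT e = t ∧ O.fires (O.cutMark hfin ι) e σ

/-- Completeness of the branching process `(O, h)`. -/
def Complete {O N : HLNet Color Var} (h : Hom O N) : Prop := CompleteSub h Set.univ

/-- The class `Nf`: finite safe high-level Petri nets with decidable guards and
finitely many reachable markings. -/
def InNf (N : HLNet Color Var) : Prop :=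
  N.NetFinite ∧ N.WellFormed ∧ N.Safe ∧ N.DecidableGuards ∧ {M | N.Reach M}.Finite

/-- The class `Nsc` of symbolically compact nets: finite safe high-level Petri nets
with decidable guards admitting a bound on the number of transition firings needed
to reach every reachable marking. -/
def InNsc (N : HLNet Color Var) : Prop :=
  N.NetFinite ∧ N.WellFormed ∧ N.Safe ∧ N.DecidableGuards ∧ ∃ n, N.BoundedReach n

/-- The modes of a transition. -/
def Mode (N : HLNet Color Var) (t : N.Trans) : Type := {σ : Var → Color // N.guard t σ}

/-- The expansion `Exp(N)`: the P/T Petri net (a high-level net over the trivial sets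
of colors and variables) with places `p.c` and transitions `t.σ`. -/
def expand (N : HLNet Color Var) : HLNet Unit Unit where
  Place := N.Place × Color
  Trans := (t : N.Trans) × N.Mode t
  preFlow tσ := (N.preMark tσ.1 tσ.2.1).map fun pc => (pc, ())
  postFlow tσ := (N.postMark tσ.1 tσ.2.1).map fun pc => (pc, ())
  guard _ _ := True
  init := (fun M : N.Marking => M.map fun pc => (pc, ())) '' N.init

def expPlaceBase (N : HLNet Color Var) : N.expand.Place → N.Place := fun pc => pc.1
def expPlaceColor (N : HLNet Color Var) : N.expand.Place → Color := fun pc => pc.2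
def expTransBase (N : HLNet Color Var) : N.expand.Trans → N.Trans := fun tσ => tσ.1
def expTransMode (N : HLNet Color Var) (tσ : N.expand.Trans) : Var → Color := tσ.2.1

/-- The constraint `constr(B')` on a co-set `B'` of conditions, evaluated on an
assignment `a` of colors to the labels `π(B')` (predb(b) for all `b ∈ B'`,
with all bound indexed variables existentially quantified at once). -/
def constrSat {O N : HLNet Color Var} (h : Hom O N) (B' : Set O.Place)
    (a : N.Place → Color) : Prop :=
  ∃ ι : O.Assign, ∀ b ∈ B', O.condPred b ι ∧ a (h.mapP b) = O.valOf ι b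

/-- `φ(E')`: the multiset of the transition labels of a finite set of events. -/
def labelMS {O N : HLNet Color Var} (h : Hom O N) (S : Set O.Trans) : Multiset N.Trans :=
  if hfin : S.Finite then hfin.toFinset.val.map h.mapT else 0

/-- Lexicographic comparison of the `≪`-sorted sequences of two multisets. -/
def msLex {α : Type} (lo : LinearOrder α) (s1 s2 : Multiset α) : Prop :=
  letI := lo
  List.Lex (· < ·) (s1.sort (· ≤ ·)) (s2.sort (· ≤ ·))

/-- `Min(S)`: the causally minimal events of `S`. -/
def minOf (O : HLNet Color Var) (S : Set O.Trans) : Set O.Trans :=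
  {e | e ∈ S ∧ ∀ e' ∈ S, ¬ O.evLT e' e}

/-- What remains of `C` after removing the first `n` blocks of its Foata normal form. -/
def foataResidual (O : HLNet Color Var) (C : Set O.Trans) : ℕ → Set O.Trans
  | 0 => C
  | n + 1 => foataResidual O C n \ O.minOf (foataResidual O C n)

/-- The `n`-th block of the Foata normal form of `C`. -/
def foataBlock (O : HLNet Color Var) (C : Set O.Trans) (n : ℕ) : Set O.Trans :=
  O.minOf (O.foataResidual C n)

/-- `FC1 ≪ FC2`: comparison of Foata normal forms. -/
def foataLex {O N : HLNet Color Var} (h : Hom O N) (lo : LinearOrder N.Trans)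
    (C1 C2 : Set O.Trans) : Prop :=
  ∃ i : ℕ, (∀ j < i, labelMS h (O.foataBlock C1 j) = labelMS h (O.foataBlock C2 j)) ∧
    msLex lo (labelMS h (O.foataBlock C1 i)) (labelMS h (O.foataBlock C2 i))

/-- McMillan's order `≺_M`: comparison by size. -/
def rM {O : HLNet Color Var} (C1 C2 : Set O.Trans) : Prop := C1.ncard < C2.ncard

/-- The order `≺_E`: by size, then lexicographically on sorted label sequences. -/
def rE {O N : HLNet Color Var} (h : Hom O N) (lo : LinearOrder N.Trans)
    (C1 C2 : Set O.Trans) : Prop :=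
  C1.ncard < C2.ncard ∨
    (C1.ncard = C2.ncard ∧ msLex lo (labelMS h C1) (labelMS h C2))

/-- The total order `≺_F`: by size, then lexicographically on sorted label sequences,
then by Foata normal forms. -/
def rF {O N : HLNet Color Var} (h : Hom O N) (lo : LinearOrder N.Trans)
    (C1 C2 : Set O.Trans) : Prop :=
  C1.ncard < C2.ncard ∨
    (C1.ncard = C2.ncard ∧ msLex lo (labelMS h C1) (labelMS h C2)) ∨
    (labelMS h C1 = labelMS h C2 ∧ foataLex h lo C1 C2)

end HLNet

namespace HLNet

variable {Color Var : Type} {N O : HLNet Color Var}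

theorem nodup_map_fst {α β : Type*} {s : Multiset (α × β)}
    (hs : ∀ a, (s.filter fun x => x.1 = a).card ≤ 1) : (s.map Prod.fst).Nodup := by
  rw [Multiset.nodup_iff_count_le_one]
  intro a
  rw [Multiset.count_map]
  simpa only [eq_comm] using hs a

theorem card_filter_fst_le_one {α β : Type*} {s : Multiset (α × β)}
    (hs : (s.map Prod.fst).Nodup) (a : α) : (s.filter fun x => x.1 = a).card ≤ 1 := by
  have := Multiset.nodup_iff_count_le_one.1 hs a
  rw [Multiset.count_map] at this
  simpa only [eq_comm] using this

theorem IsOccNet.preFlow_nodup (hO : O.IsOccNet) (e : O.Trans) :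
    ((O.preFlow e).map Prod.fst).Nodup := nodup_map_fst (hO.2.1.1 e)

theorem IsOccNet.postFlow_nodup (hO : O.IsOccNet) (e : O.Trans) :
    ((O.postFlow e).map Prod.fst).Nodup := nodup_map_fst (hO.2.1.2 e)

theorem IsOccNet.post_unique (hO : O.IsOccNet) {b : O.Place} {e e' : O.Trans} {v v' : Var}
    (h : (b, v) ∈ O.postFlow e) (h' : (b, v') ∈ O.postFlow e') : e' = e ∧ v' = v := by
  rcases hO.2.2.2.2.2 b with ⟨hb, -⟩ | ⟨⟨e₀, v₀, -, hu⟩, -⟩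
  · exact absurd h (hb e v)
  · obtain ⟨rfl, rfl⟩ := hu e v h
    exact hu e' v' h'

theorem condPre_eq_some {b : O.Place} {e : O.Trans} {v : Var}
    (h : (b, v) ∈ O.postFlow e)
    (hu : ∀ e' v', (b, v') ∈ O.postFlow e' → e' = e ∧ v' = v) :
    O.condPre b = some (e, v) := by
  have hex : ∃ ev : O.Trans × Var, (b, ev.2) ∈ O.postFlow ev.1 := ⟨(e, v), h⟩
  rw [condPre, dif_pos hex]
  obtain ⟨h1, h2⟩ := hu _ _ hex.choose_spec
  exact congrArg some (Prod.ext h1 h2)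

theorem condPre_eq_none {b : O.Place} :
    O.condPre b = none ↔ ∀ e v, (b, v) ∉ O.postFlow e := by
  unfold condPre
  split_ifs with h
  · obtain ⟨ev, hev⟩ := h
    simpa using ⟨ev.1, ev.2, hev⟩
  · simpa using h

theorem mem_postFlow_of_condPre {b : O.Place} {ev : O.Trans × Var}
    (h : O.condPre b = some ev) : (b, ev.2) ∈ O.postFlow ev.1 := by
  unfold condPre at h
  split_ifs at h with hex
  obtain rfl := Option.some.inj h
  exact hex.choose_spec

theorem IsOccNet.condPre_of_mem (hO : O.IsOccNet) {b : O.Place} {e : O.Trans} {v : Var}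
    (h : (b, v) ∈ O.postFlow e) : O.condPre b = some (e, v) :=
  condPre_eq_some h fun _ _ h' => hO.post_unique h h'

theorem IsOccNet.valOf_of_mem (hO : O.IsOccNet) {b : O.Place} {e : O.Trans} {v : Var}
    (h : (b, v) ∈ O.postFlow e) (ι : O.Assign) : O.valOf ι b = ι (Sum.inl (e, v)) := by
  rw [valOf, hO.condPre_of_mem h]

theorem valOf_of_mem_B0 {b : O.Place} (h : b ∈ O.B0) (ι : O.Assign) :
    O.valOf ι b = ι (Sum.inr b) := by
  rw [valOf, show O.condPre b = none from h]

theorem notMem_B0_of_mem {b : O.Place} {e : O.Trans} {v : Var}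
    (h : (b, v) ∈ O.postFlow e) : b ∉ O.B0 := fun hb => condPre_eq_none.1 hb e v h

theorem mem_B0_or_exists_post (O : HLNet Color Var) (b : O.Place) :
    b ∈ O.B0 ∨ ∃ e v, (b, v) ∈ O.postFlow e := by
  by_cases h : ∃ e v, (b, v) ∈ O.postFlow e
  · exact Or.inr h
  · refine Or.inl (condPre_eq_none.2 ?_)
    push Not at h
    exact h

theorem evLE_refl (e : O.Trans) : O.evLE e e := Relation.ReflTransGen.refl

theorem evLE_trans {e₁ e₂ e₃ : O.Trans} (h : O.evLE e₁ e₂) (h' : O.evLE e₂ e₃) :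
    O.evLE e₁ e₃ := Relation.ReflTransGen.trans h h'

theorem clt_of_post_pre {e e' : O.Trans} {b : O.Place} {v v' : Var}
    (h : (b, v) ∈ O.postFlow e) (h' : (b, v') ∈ O.preFlow e') : O.evLT e e' :=
  (Relation.TransGen.single (show O.arc (Sum.inr e) (Sum.inl b) from ⟨v, h⟩)).tail
    (show O.arc (Sum.inl b) (Sum.inr e') from ⟨v', h'⟩)

theorem evLE_of_post_pre {e e' : O.Trans} {b : O.Place} {v v' : Var}
    (h : (b, v) ∈ O.postFlow e) (h' : (b, v') ∈ O.preFlow e') : O.evLE e e' :=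
  (clt_of_post_pre h h').to_reflTransGen

theorem exists_post_of_cle {e : O.Trans} {b : O.Place}
    (h : O.cle (Sum.inr e) (Sum.inl b)) : ∃ e' v, (b, v) ∈ O.postFlow e' ∧ O.evLE e e' := by
  rcases Relation.ReflTransGen.cases_tail h with h | ⟨c, hc, hcb⟩
  · cases h
  · rcases c with b' | e'
    · exact hcb.elim
    · obtain ⟨v, hv⟩ := hcb
      exact ⟨e', v, hv, hc⟩

theorem evLE_cases {e' e : O.Trans} (h : O.evLE e' e) :
    e' = e ∨ ∃ b v v' e'', (b, v) ∈ O.preFlow e ∧ (b, v') ∈ O.postFlow e'' ∧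
      O.evLE e' e'' := by
  rcases Relation.ReflTransGen.cases_tail h with h | ⟨c, hc, hce⟩
  · exact Or.inl (Sum.inr.inj h).symm
  · rcases c with b | c
    · obtain ⟨v, hv⟩ := hce
      obtain ⟨e'', v', h1, h2⟩ := exists_post_of_cle hc
      exact Or.inr ⟨b, v, v', e'', hv, h1, h2⟩
    · exact hce.elim

theorem IsOccNet.evLE_antisymm (hO : O.IsOccNet) {e e' : O.Trans}
    (h : O.evLE e e') (h' : O.evLE e' e) : e = e' := by
  rcases Relation.reflTransGen_iff_eq_or_transGen.1 h with h1 | h1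
  · exact (Sum.inr.inj h1).symm
  · exact absurd (Relation.TransGen.trans_left h1 h') (hO.2.2.2.1 _)

theorem IsOccNet.cone_finite (hO : O.IsOccNet) (e : O.Trans) : (O.cone e).Finite := by
  have key : ∀ x : O.Node, ∀ e, x = Sum.inr e → (O.cone e).Finite := by
    intro x
    induction x using hO.2.2.2.2.1.induction with
    | _ x ih =>
      rintro e rfl
      have hsub : O.cone e ⊆ {e} ∪ ⋃ bv ∈ {bv | bv ∈ O.preFlow e},
          {e' | ∃ e'' v', (bv.1, v') ∈ O.postFlow e'' ∧ O.evLE e' e''} := by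
        intro e' he'
        rcases evLE_cases he' with rfl | ⟨b, v, v', e'', h1, h2, h3⟩
        · exact Or.inl rfl
        · refine Or.inr (Set.mem_biUnion (x := (b, v)) h1 ⟨e'', v', h2, h3⟩)
      refine Set.Finite.subset ?_ hsub
      refine (Set.finite_singleton e).union (Set.Finite.biUnion ?_ ?_)
      · exact (O.preFlow e).toFinset.finite_toSet.subset fun x hx => by simpa using hx
      · rintro ⟨b, v⟩ hb
        rcases O.mem_B0_or_exists_post b with h0 | ⟨e₀, v₀, h0⟩
        · refine Set.finite_empty.subset ?_
          rintro e' ⟨e'', v', h1, -⟩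
          exact (notMem_B0_of_mem h1 h0).elim
        · refine (ih (Sum.inr e₀) (clt_of_post_pre h0 hb) e₀ rfl).subset ?_
          rintro e' ⟨e'', v', h1, h2⟩
          obtain ⟨rfl, -⟩ := hO.post_unique h0 h1
          exact h2
  exact key _ e rfl

/-- All input conditions of `e` lie in the cut of `C`. -/
def Enabled (O : HLNet Color Var) (C : Set O.Trans) (e : O.Trans) : Prop :=
  ∀ b v, (b, v) ∈ O.preFlow e → b ∈ O.cut C

theorem IsConfig.eq_of_shared_pre {C : Set O.Trans} (hC : O.IsConfig C) {e e' : O.Trans}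
    (he : e ∈ C) (he' : e' ∈ C) {b : O.Place} {v v' : Var} (h : (b, v) ∈ O.preFlow e)
    (h' : (b, v') ∈ O.preFlow e') : e = e' := by
  by_contra hne
  exact hC.2.1 e he e' he' ⟨b, e, e', hne, ⟨v, h⟩, ⟨v', h'⟩, evLE_refl _, evLE_refl _⟩

theorem Enabled.mem_of_evLE (hO : O.IsOccNet) {C : Set O.Trans} {e : O.Trans}
    (hen : O.Enabled C e) (hC : ∀ e ∈ C, ∀ e', O.evLE e' e → e' ∈ C) {e' : O.Trans}
    (h : O.evLE e' e) : e' = e ∨ e' ∈ C := by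
  rcases evLE_cases h with rfl | ⟨b, v, v', e'', h1, h2, h3⟩
  · exact Or.inl rfl
  · rcases (hen b v h1).1 with hb | ⟨e₀, he₀, v₀, hb⟩
    · exact (notMem_B0_of_mem h2 hb).elim
    · obtain ⟨rfl, -⟩ := hO.post_unique hb h2
      exact Or.inr (hC _ he₀ _ h3)

theorem isInst_mono {C C' : Set O.Trans} {ι : O.Assign} (h : C ⊆ C') (hι : O.IsInst C' ι) :
    O.IsInst C ι := ⟨hι.1, fun e he => hι.2 e (h he)⟩

theorem IsInst.locPred {C : Set O.Trans} {ι : O.Assign} (hι : O.IsInst C ι) {e : O.Trans}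
    (he : e ∈ C) : O.locPred e ι := (hι.2 e he).2 e (evLE_refl e)

theorem IsConfig.insert_event (hO : O.IsOccNet) {C : Set O.Trans} (hC : O.IsConfig C)
    {ι : O.Assign} (hι : O.IsInst C ι) {e : O.Trans} (hen : O.Enabled C e)
    (hloc : O.locPred e ι) : O.IsConfig (insert e C) ∧ O.IsInst (insert e C) ι := by
  have hcl : ∀ x ∈ insert e C, ∀ e', O.evLE e' x → e' ∈ insert e C := by
    rintro x (rfl | hx) e' he'
    · exact hen.mem_of_evLE hO hC.1 he'
    · exact Or.inr (hC.1 x hx e' he')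
  have hinst : O.IsInst (insert e C) ι := by
    refine ⟨hι.1, fun x hx => ⟨hι.1, fun e' he' => ?_⟩⟩
    rcases hcl x hx e' he' with rfl | h
    · exact hloc
    · exact hι.locPred h
  refine ⟨⟨hcl, ?_, ι, hinst⟩, hinst⟩
  rintro x hx y hy ⟨b, t1, t2, hne, ⟨v1, h1⟩, ⟨v2, h2⟩, hx1, hy2⟩
  rcases hcl x hx t1 hx1 with rfl | ht1 <;> rcases hcl y hy t2 hy2 with rfl | ht2
  · exact hne rfl
  · exact (hen b v1 h1).2 ⟨t2, ht2, v2, h2⟩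
  · exact (hen b v2 h2).2 ⟨t1, ht1, v1, h1⟩
  · exact hne (hC.eq_of_shared_pre ht1 ht2 h1 h2)

theorem IsConfig.of_subset {C C' : Set O.Trans} (hC : O.IsConfig C) (h : C' ⊆ C)
    (hcl : ∀ e ∈ C', ∀ e', O.evLE e' e → e' ∈ C') : O.IsConfig C' := by
  obtain ⟨-, h2, ι, h3⟩ := hC
  exact ⟨hcl, fun e he e' he' => h2 e (h he) e' (h he'), ι, isInst_mono h h3⟩

theorem IsConfig.diff_singleton {C : Set O.Trans} (hC : O.IsConfig C)
    {e : O.Trans} (hmax : ∀ e' ∈ C, O.evLE e e' → e' = e) : O.IsConfig (C \ {e}) := by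
  refine hC.of_subset Set.sdiff_subset ?_
  rintro x ⟨hx, hxe⟩ e' he'
  refine ⟨hC.1 x hx e' he', ?_⟩
  rintro rfl
  exact hxe (hmax x hx he')

theorem IsConfig.enabled_diff_singleton (hO : O.IsOccNet) {C : Set O.Trans}
    (hC : O.IsConfig C) {e : O.Trans} (he : e ∈ C) : O.Enabled (C \ {e}) e := by
  intro b v hb
  refine ⟨?_, ?_⟩
  · rcases O.mem_B0_or_exists_post b with h0 | ⟨e₀, v₀, h0⟩
    · exact Or.inl h0
    · refine Or.inr ⟨e₀, ⟨hC.1 e he e₀ (evLE_of_post_pre h0 hb), ?_⟩, v₀, h0⟩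
      rintro rfl
      exact hO.2.2.2.1 _ (clt_of_post_pre h0 hb)
  · rintro ⟨e', ⟨he', hne⟩, v', hb'⟩
    exact hne (hC.eq_of_shared_pre he' he hb' hb)

theorem IsConfig.induction (hO : O.IsOccNet) {C₀ C : Set O.Trans} {P : Set O.Trans → Prop}
    (hC₀ : ∀ e ∈ C₀, ∀ e', O.evLE e' e → e' ∈ C₀) (hsub : C₀ ⊆ C) (hC : O.IsConfig C)
    (hfin : C.Finite) (base : P C₀)
    (step : ∀ C' e, C₀ ⊆ C' → O.IsConfig C' → e ∉ C' → O.Enabled C' e → insert e C' ⊆ C →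
      P C' → P (insert e C')) : P C := by
  suffices H : ∀ n, ∀ C', C₀ ⊆ C' → C' ⊆ C → O.IsConfig C' → (C' \ C₀).ncard = n → P C' from
    H _ C hsub subset_rfl hC rfl
  intro n
  induction n with
  | zero =>
    intro C' h1 h2 _ hn
    rw [Set.ncard_eq_zero ((hfin.subset h2).subset Set.sdiff_subset), Set.sdiff_eq_empty] at hn
    rwa [h1.antisymm hn] at base
  | succ n ih =>
    intro C' h1 h2 hC' hn
    have hf : (C' \ C₀).Finite := (hfin.subset h2).subset Set.sdiff_subset
    have hne : (C' \ C₀).Nonempty := by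
      rw [← Set.ncard_pos hf]; omega
    obtain ⟨e, ⟨heC, he₀⟩, hmax⟩ := Set.exists_max_image _ (fun e => (O.cone e).ncard) hf hne
    have hmax' : ∀ e' ∈ C', O.evLE e e' → e' = e := by
      intro e' he' hle
      by_contra hne'
      have h' : e' ∈ C' \ C₀ := ⟨he', fun h => he₀ (hC₀ e' h e hle)⟩
      refine absurd (hmax e' h') (not_le.2 (Set.ncard_lt_ncard ?_ (hO.cone_finite e')))
      refine ⟨fun x hx => evLE_trans hx hle, fun hss => hne' ?_⟩
      exact hO.evLE_antisymm (hss (evLE_refl e')) hle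
    have hins : insert e (C' \ {e}) = C' := by
      rw [Set.insert_sdiff_singleton, Set.insert_eq_of_mem heC]
    have hsub' : C₀ ⊆ C' \ {e} := fun x hx => ⟨h1 hx, fun h => he₀ (h ▸ hx)⟩
    rw [← hins]
    refine step _ e hsub' (hC'.diff_singleton hmax') (fun h => h.2 rfl)
      (hC'.enabled_diff_singleton hO heC) (by rwa [hins]) ?_
    refine ih _ hsub' (Set.sdiff_subset.trans h2) (hC'.diff_singleton hmax') ?_
    have : (C' \ C₀) \ {e} = (C' \ {e}) \ C₀ := by
      ext x; simp only [Set.mem_sdiff]; tauto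
    rw [← this, Set.ncard_sdiff_singleton_of_mem (show e ∈ C' \ C₀ from ⟨heC, he₀⟩), hn]
    rfl

theorem IsOccNet.mem_B0_iff (hO : O.IsOccNet) {K : O.Marking} (hK : K ∈ O.init) {b : O.Place} :
    b ∈ O.B0 ↔ b ∈ K.map Prod.fst := by
  rw [← Multiset.count_pos, Multiset.count_map]
  simp only [eq_comm (a := b)]
  rcases hO.2.2.2.2.2 b with ⟨h1, h2⟩ | ⟨⟨e, v, h1, -⟩, h2⟩
  · rw [h2 K hK]
    simpa using show b ∈ O.B0 from condPre_eq_none.2 h1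
  · rw [h2 K hK]
    simpa using notMem_B0_of_mem h1

theorem IsOccNet.init_nodup (hO : O.IsOccNet) {K : O.Marking} (hK : K ∈ O.init) :
    (K.map Prod.fst).Nodup := by
  refine nodup_map_fst fun b => ?_
  rcases hO.2.2.2.2.2 b with ⟨-, h2⟩ | ⟨-, h2⟩ <;> rw [h2 K hK]
  exact Nat.zero_le 1

theorem IsOccNet.B0_finite (hO : O.IsOccNet) : O.B0.Finite := by
  obtain ⟨K, hK⟩ := hO.1.1
  refine (K.map Prod.fst).toFinset.finite_toSet.subset fun b hb => ?_
  simpa using (hO.mem_B0_iff hK).1 hb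

theorem IsOccNet.cut_finite (hO : O.IsOccNet) {C : Set O.Trans} (hC : C.Finite) :
    (O.cut C).Finite := by
  refine Set.Finite.subset (hO.B0_finite.union ?_) Set.sdiff_subset
  have : O.postConds C = ⋃ e ∈ C, {b | ∃ v, (b, v) ∈ O.postFlow e} := by
    ext b; simp [postConds]
  rw [this]
  refine hC.biUnion fun e _ => ((O.postFlow e).map Prod.fst).toFinset.finite_toSet.subset ?_
  rintro b ⟨v, hv⟩
  simpa using ⟨v, hv⟩

theorem cut_empty (O : HLNet Color Var) : O.cut ∅ = O.B0 := by
  ext b; simp [cut, postConds, preConds]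

theorem IsOccNet.eq_cutMark_empty (hO : O.IsOccNet) {K : O.Marking} (hK : K ∈ O.init)
    {ι : O.Assign} (hι : ∀ b c, (b, c) ∈ K → ι (Sum.inr b) = c)
    (hfin : (O.cut ∅).Finite) : K = O.cutMark hfin ι := by
  have h1 : K.map Prod.fst = hfin.toFinset.val := by
    refine (Multiset.Nodup.ext (hO.init_nodup hK) hfin.toFinset.nodup).2 fun b => ?_
    rw [← hO.mem_B0_iff hK, Finset.mem_val, Set.Finite.mem_toFinset, cut_empty]
  rw [cutMark, ← h1, Multiset.map_map]
  conv_lhs => rw [← Multiset.map_id K]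
  refine Multiset.map_congr rfl ?_
  rintro ⟨b, c⟩ hb
  have hb0 : b ∈ O.B0 := (hO.mem_B0_iff hK).2 (Multiset.mem_map_of_mem Prod.fst hb)
  simp [valOf_of_mem_B0 hb0, hι b c hb]

theorem mark_eq_mapMarking (h : Hom O N) {C : Set O.Trans} (hfin : (O.cut C).Finite)
    (ι : O.Assign) : mark h hfin ι = h.mapMarking (O.cutMark hfin ι) := by
  simp [mark, Hom.mapMarking, cutMark, Multiset.map_map]

theorem IsOccNet.cut_insert (hO : O.IsOccNet) {C : Set O.Trans}
    (hC : ∀ e ∈ C, ∀ e', O.evLE e' e → e' ∈ C) {e : O.Trans} (he : e ∉ C) :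
    O.cut (insert e C) = (O.cut C \ {b | ∃ v, (b, v) ∈ O.preFlow e}) ∪
      {b | ∃ v, (b, v) ∈ O.postFlow e} := by
  ext b
  constructor
  · rintro ⟨hb, hn⟩
    by_cases hp : ∃ v, (b, v) ∈ O.postFlow e
    · exact Or.inr hp
    · refine Or.inl ⟨⟨?_, ?_⟩, fun h => hn ⟨e, Or.inl rfl, h⟩⟩
      · rcases hb with hb | ⟨e', rfl | he', hb⟩
        · exact Or.inl hb
        · exact (hp hb).elim
        · exact Or.inr ⟨e', he', hb⟩
      · rintro ⟨e', he', h'⟩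
        exact hn ⟨e', Or.inr he', h'⟩
  · rintro (⟨⟨hb, hn⟩, hne⟩ | ⟨v, hv⟩)
    · refine ⟨?_, ?_⟩
      · rcases hb with hb | ⟨e', he', hb⟩
        · exact Or.inl hb
        · exact Or.inr ⟨e', Or.inr he', hb⟩
      · rintro ⟨e', rfl | he', h'⟩
        · exact hne h'
        · exact hn ⟨e', he', h'⟩
    · refine ⟨Or.inr ⟨e, Or.inl rfl, v, hv⟩, ?_⟩
      rintro ⟨e', rfl | he', v', h'⟩
      · exact hO.2.2.2.1 _ (clt_of_post_pre hv h')
      · exact he (hC e' he' e (evLE_of_post_pre hv h'))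

theorem notMem_cut_of_mem_post (hO : O.IsOccNet) {C : Set O.Trans} {e : O.Trans} (he : e ∉ C)
    {b : O.Place} {v : Var} (hb : (b, v) ∈ O.postFlow e) : b ∉ O.cut C := by
  rintro ⟨h | ⟨e', he', v', h⟩, -⟩
  · exact notMem_B0_of_mem hb h
  · obtain ⟨rfl, -⟩ := hO.post_unique hb h
    exact he he'

theorem Enabled.notMem {C : Set O.Trans} {e : O.Trans} (hen : O.Enabled C e)
    (hne : O.preFlow e ≠ 0) : e ∉ C := by
  obtain ⟨⟨b, v⟩, hb⟩ := Multiset.exists_mem_of_ne_zero hne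
  exact fun he => (hen b v hb).2 ⟨e, he, v, hb⟩

theorem cut_insert_multiset (hO : O.IsOccNet) {C : Set O.Trans}
    (hC : ∀ e ∈ C, ∀ e', O.evLE e' e → e' ∈ C) {e : O.Trans} (he : e ∉ C)
    (hen : O.Enabled C e) (hfin : (O.cut C).Finite) (hfin' : (O.cut (insert e C)).Finite) :
    hfin'.toFinset.val + (O.preFlow e).map Prod.fst =
      hfin.toFinset.val + (O.postFlow e).map Prod.fst := by
  refine (Multiset.Nodup.ext ?_ ?_).2 fun b => ?_
  · refine (Multiset.Nodup.add_iff hfin'.toFinset.nodup (hO.preFlow_nodup e)).2 ?_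
    rw [Multiset.disjoint_left]
    rintro b hb hb'
    obtain ⟨⟨b, v⟩, hv, rfl⟩ := Multiset.mem_map.1 hb'
    exact (hfin'.mem_toFinset.1 hb).2 ⟨e, Or.inl rfl, v, hv⟩
  · refine (Multiset.Nodup.add_iff hfin.toFinset.nodup (hO.postFlow_nodup e)).2 ?_
    rw [Multiset.disjoint_left]
    rintro b hb hb'
    obtain ⟨⟨b, v⟩, hv, rfl⟩ := Multiset.mem_map.1 hb'
    exact notMem_cut_of_mem_post hO he hv (hfin.mem_toFinset.1 hb)
  · have hpre : (∃ v, (b, v) ∈ O.preFlow e) → b ∈ O.cut C := fun ⟨v, hv⟩ => hen b v hv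
    simp only [Multiset.mem_add, Finset.mem_val, Set.Finite.mem_toFinset, hO.cut_insert hC he,
      Multiset.mem_map, Prod.exists, exists_and_right, exists_eq_right, Set.mem_union,
      Set.mem_sdiff, Set.mem_ofPred_eq]
    tauto

theorem preMark_eq (h : Hom O N) {e : O.Trans} {ι : O.Assign} (hloc : O.locPred e ι) :
    N.preMark (h.mapT e) (fun v => ι (Sum.inl (e, v))) =
      ((O.preFlow e).map Prod.fst).map fun b => (h.mapP b, O.valOf ι b) := by
  rw [preMark, h.pre_eq, Multiset.map_map, Multiset.map_map]
  refine Multiset.map_congr rfl fun bv hbv => ?_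
  simp [hloc.2 bv hbv]

theorem postMark_eq (hO : O.IsOccNet) (h : Hom O N) (e : O.Trans) (ι : O.Assign) :
    N.postMark (h.mapT e) (fun v => ι (Sum.inl (e, v))) =
      ((O.postFlow e).map Prod.fst).map fun b => (h.mapP b, O.valOf ι b) := by
  rw [postMark, h.post_eq, Multiset.map_map, Multiset.map_map]
  refine Multiset.map_congr rfl fun bv hbv => ?_
  simp [hO.valOf_of_mem (show (bv.1, bv.2) ∈ O.postFlow e from hbv)]

theorem Enabled.preFlow_le (hO : O.IsOccNet) {C : Set O.Trans} {e : O.Trans}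
    (hen : O.Enabled C e) (hfin : (O.cut C).Finite) :
    (O.preFlow e).map Prod.fst ≤ hfin.toFinset.val := by
  rw [Multiset.le_iff_subset (hO.preFlow_nodup e)]
  intro b hb
  obtain ⟨⟨b, v⟩, hv, rfl⟩ := Multiset.mem_map.1 hb
  exact hfin.mem_toFinset.2 (hen b v hv)

theorem Enabled.firesTo_mark (hO : O.IsOccNet) (h : Hom O N) {C : Set O.Trans}
    (hC : ∀ e ∈ C, ∀ e', O.evLE e' e → e' ∈ C) {e : O.Trans} (he : e ∉ C)
    (hen : O.Enabled C e) {ι : O.Assign} (hloc : O.locPred e ι)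
    (hfin : (O.cut C).Finite) (hfin' : (O.cut (insert e C)).Finite) :
    N.firesTo (mark h hfin ι) (h.mapT e) (fun v => ι (Sum.inl (e, v))) (mark h hfin' ι) := by
  have hle := Multiset.map_le_map (f := fun b => (h.mapP b, O.valOf ι b))
    (hen.preFlow_le hO hfin)
  have heq := congrArg (Multiset.map fun b => (h.mapP b, O.valOf ι b))
    (cut_insert_multiset hO hC he hen hfin hfin')
  rw [Multiset.map_add, Multiset.map_add] at heq
  rw [← preMark_eq h hloc] at heq hle
  rw [← postMark_eq hO h e ι] at heq
  refine ⟨⟨(h.guard_iff e _).1 hloc.1, hle⟩, ?_⟩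
  rw [show mark h hfin ι = hfin.toFinset.val.map fun b => (h.mapP b, O.valOf ι b) from rfl,
    tsub_add_eq_add_tsub hle]
  exact eq_tsub_of_add_eq heq

theorem IsConfig.reach (hO : O.IsOccNet) {h : Hom O N} (hI : h.Initial) {C : Set O.Trans}
    (hC : O.IsConfig C) (hCf : C.Finite) {ι : O.Assign} (hι : O.IsInst C ι)
    (hfin : (O.cut C).Finite) : N.Reach (mark h hfin ι) := by
  suffices H : ∀ hfin : (O.cut C).Finite, N.Reach (mark h hfin ι) from H hfin
  refine hC.induction (P := fun C => ∀ hfin : (O.cut C).Finite, N.Reach (mark h hfin ι)) hO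
    (C₀ := ∅) (by simp) (Set.empty_subset C) hCf ?_ ?_
  · intro hfin
    obtain ⟨K, hK, hKι⟩ := hι.1
    rw [mark_eq_mapMarking, ← hO.eq_cutMark_empty hK hKι]
    exact Reach.init (hI ▸ Set.mem_image_of_mem _ hK)
  · intro C' e _ hC' he hen hsub ih hfin'
    have hfin := hO.cut_finite (hCf.subset ((Set.subset_insert e C').trans hsub))
    exact Reach.step (ih hfin)
      (hen.firesTo_mark hO h hC'.1 he (hι.locPred (hsub (Or.inl rfl))) hfin hfin')

theorem Safe.nodup (hN : N.Safe) {M : N.Marking} (hM : N.Reach M) : (M.map Prod.fst).Nodup :=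
  nodup_map_fst (hN M hM)

theorem Safe.injOn_cut (hN : N.Safe) (hO : O.IsOccNet) {h : Hom O N} (hI : h.Initial)
    {C : Set O.Trans} (hC : O.IsConfig C) (hCf : C.Finite) : Set.InjOn h.mapP (O.cut C) := by
  obtain ⟨ι, hι⟩ := hC.2.2
  have hfin := hO.cut_finite hCf
  have hnd := hN.nodup (hC.reach hO hI hCf hι hfin)
  rw [mark, Multiset.map_map] at hnd
  intro b hb b' hb' hbb
  exact Multiset.inj_on_of_nodup_map hnd b (hfin.mem_toFinset.2 hb) b' (hfin.mem_toFinset.2 hb') hbb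

theorem IsSBP.isConfig_cone {h : Hom O N} (hS : IsSBP h) (e : O.Trans) :
    O.IsConfig (O.cone e) := by
  obtain ⟨ι, hι⟩ := hS.2.2.1 e
  refine ⟨fun x hx y hy => evLE_trans hy hx, ?_, ι, hι.1, fun x hx => ⟨hι.1, fun y hy => hι.2 y (evLE_trans hy hx)⟩⟩
  rintro x hx y hy ⟨b, t1, t2, hne, h1, h2, h3, h4⟩
  exact hS.1.2.2.1 e ⟨b, t1, t2, hne, h1, h2, evLE_trans h3 hx, evLE_trans h4 hy⟩

theorem IsOccNet.post_mem_cut_cone (hO : O.IsOccNet) {e : O.Trans} {b : O.Place} {v : Var}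
    (hb : (b, v) ∈ O.postFlow e) : b ∈ O.cut (O.cone e) := by
  refine ⟨Or.inr ⟨e, evLE_refl e, v, hb⟩, ?_⟩
  rintro ⟨e', he', v', hb'⟩
  exact hO.2.2.2.1 _ (Relation.TransGen.trans_left (clt_of_post_pre hb hb') he')

theorem Safe.injOn_post (hN : N.Safe) {h : Hom O N} (hS : IsSBP h) (e : O.Trans) :
    Set.InjOn h.mapP {b | ∃ v, (b, v) ∈ O.postFlow e} := by
  refine (hN.injOn_cut hS.1 hS.2.1 (hS.isConfig_cone e) (hS.1.cone_finite e)).mono ?_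
  rintro b ⟨v, hb⟩
  exact hS.1.post_mem_cut_cone hb

/-- Two assignments agreeing on the initial conditions and on the variables of the events
of `C`. -/
def AgreeOn (O : HLNet Color Var) (C : Set O.Trans) (ι ι' : O.Assign) : Prop :=
  (∀ b, ι (Sum.inr b) = ι' (Sum.inr b)) ∧
    ∀ e ∈ C, ∀ v, ι (Sum.inl (e, v)) = ι' (Sum.inl (e, v))

theorem AgreeOn.valOf_eq {C : Set O.Trans} {ι ι' : O.Assign} (h : O.AgreeOn C ι ι')
    {b : O.Place} (hb : b ∈ O.B0 ∪ O.postConds C) (hO : O.IsOccNet) :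
    O.valOf ι b = O.valOf ι' b := by
  rcases hb with hb | ⟨e, he, v, hb⟩
  · rw [valOf_of_mem_B0 hb, valOf_of_mem_B0 hb, h.1]
  · rw [hO.valOf_of_mem hb, hO.valOf_of_mem hb, h.2 e he]

theorem AgreeOn.isInst {C : Set O.Trans} {ι ι' : O.Assign} (h : O.AgreeOn C ι ι')
    (hO : O.IsOccNet) (hC : ∀ e ∈ C, ∀ e', O.evLE e' e → e' ∈ C) (hι : O.IsInst C ι) :
    O.IsInst C ι' := by
  have hbot : O.predBot ι' := by
    obtain ⟨K, hK, hKι⟩ := hι.1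
    exact ⟨K, hK, fun b c hbc => (h.1 b).symm.trans (hKι b c hbc)⟩
  refine ⟨hbot, fun e he => ⟨hbot, fun e' he' => ?_⟩⟩
  have heC := hC e he e' he'
  obtain ⟨h1, h2⟩ := hι.locPred heC
  refine ⟨?_, fun bv hbv => ?_⟩
  · simpa only [h.2 e' heC] using h1
  · have h3 := h2 bv hbv
    rw [h.2 e' heC] at h3
    rw [h3]
    refine h.valOf_eq ?_ hO
    rcases O.mem_B0_or_exists_post bv.1 with h0 | ⟨e₀, v₀, h0⟩
    · exact Or.inl h0
    · exact Or.inr ⟨e₀, hC e' heC _ (evLE_of_post_pre h0 (v' := bv.2) hbv), v₀, h0⟩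

theorem AgreeOn.mark_eq {C : Set O.Trans} {ι ι' : O.Assign} (h : O.AgreeOn C ι ι')
    (hO : O.IsOccNet) (φ : Hom O N) (hfin : (O.cut C).Finite) :
    mark φ hfin ι = mark φ hfin ι' := by
  refine Multiset.map_congr rfl fun b hb => ?_
  rw [h.valOf_eq ((hfin.mem_toFinset.1 hb).1) hO]

/-- The assignment `ι` with the variables of `e` set according to `σ`. -/
def Assign.setMode (ι : O.Assign) (e : O.Trans) (σ : Var → Color) : O.Assign
  | Sum.inl (e', v) => if e' = e then σ v else ι (Sum.inl (e', v))
  | Sum.inr b => ι (Sum.inr b)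

theorem agreeOn_setMode {C : Set O.Trans} {e : O.Trans} (he : e ∉ C) (ι : O.Assign)
    (σ : Var → Color) : O.AgreeOn C ι (Assign.setMode ι e σ) := by
  refine ⟨fun b => rfl, fun e' he' v => ?_⟩
  have : e' ≠ e := fun h => he (h ▸ he')
  simp [Assign.setMode, this]

theorem IsSBP.exists_isInst_empty {h : Hom O N} (hS : IsSBP h) {K : O.Marking}
    (hK : K ∈ O.init) :
    ∃ ι, O.IsInst ∅ ι ∧ ∀ b c, (b, c) ∈ K → ι (Sum.inr b) = c := by
  have hO := hS.1
  have hex : ∀ x : (O.Trans × Var) ⊕ O.Place, ∃ c : Color,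
      ∀ b, x = Sum.inr b → ∀ c', (b, c') ∈ K → c = c' := by
    rintro (⟨e, v⟩ | b)
    · obtain ⟨ι, -⟩ := hS.2.2.1 e
      exact ⟨ι (Sum.inl (e, v)), by simp⟩
    · by_cases hb : ∃ c, (b, c) ∈ K
      · obtain ⟨c, hc⟩ := hb
        refine ⟨c, ?_⟩
        rintro b' heq c' hc'
        obtain rfl := Sum.inr.inj heq
        exact congrArg Prod.snd (Multiset.inj_on_of_nodup_map (hO.init_nodup hK) _ hc _ hc' rfl)
      · rcases O.mem_B0_or_exists_post b with hB | ⟨e, v, hB⟩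
        · obtain ⟨⟨b', c⟩, hc, rfl⟩ := Multiset.mem_map.1 ((hO.mem_B0_iff hK).1 hB)
          exact (hb ⟨c, hc⟩).elim
        · obtain ⟨ι, -⟩ := hS.2.2.1 e
          refine ⟨ι (Sum.inl (e, v)), ?_⟩
          rintro b' heq c' hc'
          obtain rfl := Sum.inr.inj heq
          exact (hb ⟨c', hc'⟩).elim
  choose ι hι using hex
  exact ⟨ι, ⟨⟨K, hK, fun b c hbc => hι _ b rfl c hbc⟩, by simp⟩, fun b c hbc => hι _ b rfl c hbc⟩

/-- A label-preserving initial endomorphism of a branching process of a safe net is the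
identity. -/
theorem Safe.endomorphism_eq_id (hN : N.Safe) {h : Hom O N} (hS : IsSBP h) (ψ : Hom O O)
    (hψ : ψ.Initial) (hP : ∀ b, h.mapP (ψ.mapP b) = h.mapP b)
    (hT : ∀ e, h.mapT (ψ.mapT e) = h.mapT e) :
    (∀ b, ψ.mapP b = b) ∧ ∀ e, ψ.mapT e = e := by
  have hO := hS.1
  have key : ∀ x : O.Node, Sum.map ψ.mapP ψ.mapT x = x := by
    intro x
    induction x using hO.2.2.2.2.1.induction with
    | _ x ih =>
      rcases x with b | e
      · rcases O.mem_B0_or_exists_post b with hb | ⟨e, v, hb⟩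
        · obtain ⟨K, hK⟩ := hO.1.1
          have hK' : ψ.mapMarking K ∈ O.init := hψ ▸ Set.mem_image_of_mem _ hK
          obtain ⟨⟨b', c⟩, hbc, rfl⟩ := Multiset.mem_map.1 ((hO.mem_B0_iff hK).1 hb)
          have hψb : ψ.mapP b' ∈ O.B0 := (hO.mem_B0_iff hK').2
            (Multiset.mem_map_of_mem Prod.fst (Multiset.mem_map_of_mem _ hbc))
          obtain ⟨ι, hι, -⟩ := hS.exists_isInst_empty hK
          have hcfg : O.IsConfig ∅ := ⟨by simp, by simp, ι, hι⟩
          refine congrArg Sum.inl (hN.injOn_cut hO hS.2.1 hcfg Set.finite_empty ?_ ?_ (hP b'))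
          · rwa [cut_empty]
          · rwa [cut_empty]
        · have he : ψ.mapT e = e := Sum.inr.inj (ih (Sum.inr e) (.single ⟨v, hb⟩))
          have hψb : (ψ.mapP b, v) ∈ O.postFlow e := by
            have := ψ.post_eq e
            rw [he] at this
            rw [this]
            exact Multiset.mem_map.2 ⟨(b, v), hb, rfl⟩
          exact congrArg Sum.inl (hN.injOn_post hS e ⟨v, hψb⟩ ⟨v, hb⟩ (hP b))
      · refine congrArg Sum.inr (hS.2.2.2 _ _ ?_ (hT e))
        rw [ψ.pre_eq e]
        conv_rhs => rw [← Multiset.map_id (O.preFlow e)]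
        refine Multiset.map_congr rfl fun bv hbv => ?_
        have := Sum.inl.inj (ih (Sum.inl bv.1) (.single ⟨bv.2, hbv⟩))
        exact Prod.ext this rfl
  exact ⟨fun b => Sum.inl.inj (key (Sum.inl b)), fun e => Sum.inr.inj (key (Sum.inr e))⟩

/-- The net `O` with one more event, labeled `t`, with preset `X` and a fresh postset. -/
abbrev addEvent (O : HLNet Color Var) (t : N.Trans) (X : Multiset (O.Place × Var)) :
    HLNet Color Var where
  Place := O.Place ⊕ {pv // pv ∈ N.postFlow t}
  Trans := Option O.Trans
  preFlow e := (e.elim X O.preFlow).map fun bv => (Sum.inl bv.1, bv.2)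
  postFlow e := e.elim ((N.postFlow t).attach.map fun pv => (Sum.inr pv, pv.1.2))
    fun e => (O.postFlow e).map fun bv => (Sum.inl bv.1, bv.2)
  guard e := e.elim (N.guard t) O.guard
  init := Multiset.map (fun bc => (Sum.inl bc.1, bc.2)) '' O.init

section AddEvent

variable {t : N.Trans} {X : Multiset (O.Place × Var)}

/-- The labeling of `addEvent`. -/
def addEventHom (h : Hom O N) (hX : X.map (fun bv => (h.mapP bv.1, bv.2)) = N.preFlow t) :
    Hom (addEvent O t X) N where
  mapP := Sum.elim h.mapP fun pv => pv.1.1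
  mapT e := e.elim t h.mapT
  guard_iff
    | none, _ => Iff.rfl
    | some e, σ => h.guard_iff e σ
  pre_eq
    | none => by
      simp only [Option.elim_none, Multiset.map_map, ← hX]
      rfl
    | some e => by
      simp only [Option.elim_some, Multiset.map_map, h.pre_eq]
      rfl
  post_eq
    | none => by
      simp only [addEvent, Option.elim_none, Multiset.map_map, Function.comp_def, Sum.elim_inr]
      exact (Multiset.attach_map_val _).symm
    | some e => by
      simp only [Option.elim_some, Multiset.map_map, h.post_eq]
      rfl

theorem mem_addEvent_preFlow {e : Option O.Trans} {b v} :
    (b, v) ∈ (addEvent O t X).preFlow e ↔ ∃ b', (b', v) ∈ e.elim X O.preFlow ∧ Sum.inl b' = b := by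
  simp only [addEvent, Multiset.mem_map, Prod.mk.injEq, Prod.exists]
  constructor
  · rintro ⟨b', v', h1, h2, rfl⟩
    exact ⟨b', h1, h2⟩
  · rintro ⟨b', h1, h2⟩
    exact ⟨b', v, h1, h2, rfl⟩

theorem mem_addEvent_postFlow_inl {e : Option O.Trans} {b : O.Place} {v : Var} :
    (Sum.inl b, v) ∈ (addEvent O t X).postFlow e ↔ ∃ e', e = some e' ∧ (b, v) ∈ O.postFlow e' := by
  cases e <;> simp [addEvent]

theorem mem_addEvent_postFlow_inr {e : Option O.Trans} {pv : {pv // pv ∈ N.postFlow t}} {v : Var} :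
    (Sum.inr pv, v) ∈ (addEvent O t X).postFlow e ↔ e = none ∧ v = pv.1.2 := by
  cases e
  · simp [addEvent, eq_comm]
  · simp [addEvent]

theorem addEvent_condPre_inl (hO : O.IsOccNet) (b : O.Place) :
    (addEvent O t X).condPre (Sum.inl b) = (O.condPre b).map fun ev => (some ev.1, ev.2) := by
  rcases O.mem_B0_or_exists_post b with hb | ⟨e, v, hb⟩
  · rw [show O.condPre b = none from hb]
    refine condPre_eq_none.2 fun e v h => ?_
    obtain ⟨e', -, h'⟩ := mem_addEvent_postFlow_inl.1 h
    exact notMem_B0_of_mem h' hb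
  · rw [hO.condPre_of_mem hb]
    refine condPre_eq_some (mem_addEvent_postFlow_inl.2 ⟨e, rfl, hb⟩) fun e' v' h => ?_
    obtain ⟨e'', rfl, h'⟩ := mem_addEvent_postFlow_inl.1 h
    obtain ⟨rfl, rfl⟩ := hO.post_unique hb h'
    exact ⟨rfl, rfl⟩

/-- The embedding of the nodes of `O` into those of `addEvent`. -/
def addEventNode (t : N.Trans) (X : Multiset (O.Place × Var)) : O.Node → (addEvent O t X).Node :=
  Sum.map Sum.inl some

theorem addEvent_arc_lift {y : (addEvent O t X).Node} {x : O.Node}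
    (h : (addEvent O t X).arc y (addEventNode t X x)) :
    ∃ y', y = addEventNode t X y' ∧ O.arc y' x := by
  rcases x with b | e <;> rcases y with b' | e'
  · exact h.elim
  · obtain ⟨v, hv⟩ := h
    obtain ⟨e'', rfl, h'⟩ := mem_addEvent_postFlow_inl.1 hv
    exact ⟨Sum.inr e'', rfl, v, h'⟩
  · obtain ⟨v, hv⟩ := h
    obtain ⟨b'', h', rfl⟩ := mem_addEvent_preFlow.1 hv
    exact ⟨Sum.inl b'', rfl, v, h'⟩
  · exact h.elim

theorem addEvent_cle_lift {y : (addEvent O t X).Node} {x : O.Node}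
    (h : (addEvent O t X).cle y (addEventNode t X x)) :
    ∃ y', y = addEventNode t X y' ∧ O.cle y' x := by
  induction h using Relation.ReflTransGen.head_induction_on with
  | refl => exact ⟨x, rfl, .refl⟩
  | head h1 _ ih =>
    obtain ⟨y', rfl, h3⟩ := ih
    obtain ⟨z, rfl, h4⟩ := addEvent_arc_lift h1
    exact ⟨z, rfl, .head h4 h3⟩

theorem addEvent_evLE_lift {e' : Option O.Trans} {e : O.Trans}
    (h : (addEvent O t X).evLE e' (some e)) : ∃ e'', e' = some e'' ∧ O.evLE e'' e := by
  obtain ⟨y, hy, h'⟩ := addEvent_cle_lift (x := Sum.inr e) h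
  rcases y with b | e''
  · cases hy
  · exact ⟨e'', Sum.inr.inj hy, h'⟩

theorem addEvent_evLE_none (hO : O.IsOccNet) {C : Set O.Trans} (hC : O.IsConfig C)
    (hX : ∀ bv ∈ X, bv.1 ∈ O.cut C) {e' : Option O.Trans}
    (h : (addEvent O t X).evLE e' none) : e' = none ∨ ∃ e'' ∈ C, e' = some e'' := by
  rcases evLE_cases h with rfl | ⟨b, v, v', e'', h1, h2, h3⟩
  · exact Or.inl rfl
  · obtain ⟨b, hb, rfl⟩ := mem_addEvent_preFlow.1 h1
    obtain ⟨e₁, rfl, h2'⟩ := mem_addEvent_postFlow_inl.1 h2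
    obtain ⟨e₂, rfl, h3'⟩ := addEvent_evLE_lift h3
    rcases (hX _ hb).1 with h0 | ⟨e₀, he₀, v₀, h0⟩
    · exact (notMem_B0_of_mem h2' h0).elim
    · obtain ⟨rfl, -⟩ := hO.post_unique h0 h2'
      exact Or.inr ⟨e₂, hC.1 _ he₀ _ h3', rfl⟩

theorem addEvent_wellFounded (hO : O.IsOccNet) : WellFounded (addEvent O t X).clt := by
  have hnode : ∀ x : O.Node, Acc (addEvent O t X).arc (addEventNode t X x) := by
    intro x
    induction x using hO.2.2.2.2.1.induction with
    | _ x ih =>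
      refine Acc.intro _ fun y hy => ?_
      obtain ⟨y', rfl, h⟩ := addEvent_arc_lift hy
      exact ih y' (.single h)
  have hnone : Acc (addEvent O t X).arc (Sum.inr none) := by
    refine Acc.intro _ fun y hy => ?_
    rcases y with b | e
    · obtain ⟨v, hv⟩ := hy
      obtain ⟨b', -, rfl⟩ := mem_addEvent_preFlow.1 hv
      exact hnode (Sum.inl b')
    · exact hy.elim
  refine WellFounded.transGen ⟨fun x => ?_⟩
  rcases x with (b | pv) | (_ | e)
  · exact hnode (Sum.inl b)
  · refine Acc.intro _ fun y hy => ?_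
    rcases y with b | e
    · exact hy.elim
    · obtain ⟨v, hv⟩ := hy
      obtain ⟨rfl, -⟩ := mem_addEvent_postFlow_inr.1 hv
      exact hnone
  · exact hnone
  · exact hnode (Sum.inr e)

theorem addEvent_isOccNet (hO : O.IsOccNet) {C : Set O.Trans} (hC : O.IsConfig C)
    (hX : ∀ bv ∈ X, bv.1 ∈ O.cut C) (hXn : (X.map Prod.fst).Nodup)
    (ht : ((N.postFlow t).map Prod.fst).Nodup) : (addEvent O t X).IsOccNet := by
  have hwf := addEvent_wellFounded (t := t) (X := X) hO
  refine ⟨⟨hO.1.1.image _, ?_⟩, ⟨fun e => ?_, fun e => ?_⟩, fun e => ?_, fun x hx => ?_, hwf, ?_⟩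
  · rintro _ ⟨K, hK, rfl⟩ _ ⟨K', hK', rfl⟩
    have := congrArg (Multiset.map (Sum.inl (β := {pv // pv ∈ N.postFlow t})))
      (hO.1.2 K hK K' hK')
    simpa [Multiset.map_map, Function.comp_def, addEvent] using this
  · refine card_filter_fst_le_one ?_
    have hnd : ((e.elim X O.preFlow).map Prod.fst).Nodup := by
      cases e
      · exact hXn
      · exact hO.preFlow_nodup _
    have := hnd.map (Sum.inl_injective (β := {pv // pv ∈ N.postFlow t}))
    simpa [Multiset.map_map, Function.comp_def, addEvent] using this
  · refine card_filter_fst_le_one ?_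
    cases e with
    | none =>
      have hnd : (N.postFlow t).attach.Nodup := Multiset.nodup_attach.2 (Multiset.Nodup.of_map _ ht)
      have := hnd.map (Sum.inr_injective (α := O.Place))
      simpa [Multiset.map_map, Function.comp_def, addEvent] using this
    | some e =>
      have := (hO.postFlow_nodup e).map (Sum.inl_injective (β := {pv // pv ∈ N.postFlow t}))
      simpa [Multiset.map_map, Function.comp_def, addEvent] using this
  · rintro ⟨b, t1, t2, hne, ⟨v1, h1⟩, ⟨v2, h2⟩, h3, h4⟩
    obtain ⟨b, h1', rfl⟩ := mem_addEvent_preFlow.1 h1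
    obtain ⟨b', h2', hb'⟩ := mem_addEvent_preFlow.1 h2
    obtain rfl := Sum.inl.inj hb'
    cases e with
    | some e =>
      obtain ⟨t1, rfl, h3'⟩ := addEvent_evLE_lift h3
      obtain ⟨t2, rfl, h4'⟩ := addEvent_evLE_lift h4
      exact hO.2.2.1 e
        ⟨b', t1, t2, fun h => hne (congrArg some h), ⟨v1, h1'⟩, ⟨v2, h2'⟩, h3', h4'⟩
    | none =>
      rcases addEvent_evLE_none hO hC hX h3 with rfl | ⟨t1, ht1, rfl⟩ <;>
        rcases addEvent_evLE_none hO hC hX h4 with rfl | ⟨t2, ht2, rfl⟩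
      · exact hne rfl
      · exact (hX _ h1').2 ⟨t2, ht2, v2, h2'⟩
      · exact (hX _ h2').2 ⟨t1, ht1, v1, h1'⟩
      · exact hne (congrArg some (hC.eq_of_shared_pre ht1 ht2 h1' h2'))
  · exact hwf.irrefl.irrefl x hx
  · have hcard : ∀ (K : O.Marking) (b : O.Place),
        ((K.map fun bc => ((Sum.inl bc.1 : (addEvent O t X).Place), bc.2)).filter
          fun bc => bc.1 = Sum.inl b).card = (K.filter fun bc => bc.1 = b).card := by
      intro K b
      rw [Multiset.filter_map, Multiset.card_map]
      simp
    rintro (b | pv)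
    · rcases hO.2.2.2.2.2 b with ⟨h1, h2⟩ | ⟨⟨e, v, h1, h3⟩, h2⟩
      · refine Or.inl ⟨fun e v h => ?_, ?_⟩
        · obtain ⟨e', -, h'⟩ := mem_addEvent_postFlow_inl.1 h
          exact h1 e' v h'
        · rintro _ ⟨K, hK, rfl⟩
          convert (hcard K b).trans (h2 K hK)
      · refine Or.inr ⟨⟨some e, v, mem_addEvent_postFlow_inl.2 ⟨e, rfl, h1⟩, fun e' v' h => ?_⟩, ?_⟩
        · obtain ⟨e'', rfl, h'⟩ := mem_addEvent_postFlow_inl.1 h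
          obtain ⟨rfl, rfl⟩ := h3 e'' v' h'
          exact ⟨rfl, rfl⟩
        · rintro _ ⟨K, hK, rfl⟩
          convert (hcard K b).trans (h2 K hK)
    · refine Or.inr ⟨⟨none, pv.1.2, mem_addEvent_postFlow_inr.2 ⟨rfl, rfl⟩, fun e' v' h =>
        mem_addEvent_postFlow_inr.1 h⟩, ?_⟩
      rintro _ ⟨K, hK, rfl⟩
      rw [Multiset.filter_map, Multiset.card_map]
      simp

/-- The extension of an assignment to the added event, via a mode `σ` for it. -/
def addEventAssign (t : N.Trans) (X : Multiset (O.Place × Var)) (ι : O.Assign)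
    (σ : Var → Color) : (addEvent O t X).Assign
  | Sum.inl (none, v) => σ v
  | Sum.inl (some e, v) => ι (Sum.inl (e, v))
  | Sum.inr (Sum.inl b) => ι (Sum.inr b)
  | Sum.inr (Sum.inr pv) => σ pv.1.2

theorem addEvent_valOf_inl (hO : O.IsOccNet) (ι : O.Assign) (σ : Var → Color) (b : O.Place) :
    (addEvent O t X).valOf (addEventAssign t X ι σ) (Sum.inl b) = O.valOf ι b := by
  unfold valOf
  rw [addEvent_condPre_inl hO]
  cases O.condPre b <;> rfl

theorem addEvent_predBot {ι : O.Assign} (hι : O.predBot ι) (σ : Var → Color) :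
    (addEvent O t X).predBot (addEventAssign t X ι σ) := by
  obtain ⟨K, hK, hKι⟩ := hι
  refine ⟨_, Set.mem_image_of_mem _ hK, fun b c hbc => ?_⟩
  obtain ⟨⟨b', c'⟩, hbc', heq⟩ := Multiset.mem_map.1 hbc
  obtain ⟨rfl, rfl⟩ := Prod.mk.inj heq
  exact hKι _ _ hbc'

theorem addEvent_locPred_some (hO : O.IsOccNet) {ι : O.Assign} {e : O.Trans}
    (hι : O.locPred e ι) (σ : Var → Color) :
    (addEvent O t X).locPred (some e) (addEventAssign t X ι σ) := by
  refine ⟨hι.1, ?_⟩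
  rintro ⟨b, v⟩ hbv
  obtain ⟨b, hb, rfl⟩ := mem_addEvent_preFlow.1 hbv
  rw [addEvent_valOf_inl hO]
  exact hι.2 (b, v) hb

theorem addEvent_locPred_none (hO : O.IsOccNet) {ι : O.Assign} {σ : Var → Color}
    (hg : N.guard t σ) (hσ : ∀ bv ∈ X, σ bv.2 = O.valOf ι bv.1) :
    (addEvent O t X).locPred none (addEventAssign t X ι σ) := by
  refine ⟨hg, ?_⟩
  rintro ⟨b, v⟩ hbv
  obtain ⟨b, hb, rfl⟩ := mem_addEvent_preFlow.1 hbv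
  rw [addEvent_valOf_inl hO]
  exact hσ (b, v) hb

theorem addEvent_isSBP {h : Hom O N} (hS : IsSBP h)
    (hXt : X.map (fun bv => (h.mapP bv.1, bv.2)) = N.preFlow t)
    {C : Set O.Trans} (hC : O.IsConfig C) {ι : O.Assign} (hι : O.IsInst C ι)
    (hX : ∀ bv ∈ X, bv.1 ∈ O.cut C) (hXn : (X.map Prod.fst).Nodup)
    (ht : ((N.postFlow t).map Prod.fst).Nodup) {σ : Var → Color}
    (hg : N.guard t σ) (hσ : ∀ bv ∈ X, σ bv.2 = O.valOf ι bv.1)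
    (hnew : ∀ e, O.preFlow e = X → h.mapT e ≠ t) : IsSBP (addEventHom h hXt) := by
  have hO := hS.1
  refine ⟨addEvent_isOccNet hO hC hX hXn ht, ?_, ?_, ?_⟩
  · rw [Hom.Initial, ← hS.2.1]
    simp only [addEvent, Set.image_image]
    refine Set.image_congr' fun K => ?_
    simp only [Hom.mapMarking, Multiset.map_map, addEventHom]
    rfl
  · rintro (_ | e)
    · refine ⟨addEventAssign t X ι σ, addEvent_predBot hι.1 σ, fun e' he' => ?_⟩
      rcases addEvent_evLE_none hO hC hX he' with rfl | ⟨e'', he'', rfl⟩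
      · exact addEvent_locPred_none hO hg hσ
      · exact addEvent_locPred_some hO (hι.locPred he'') σ
    · obtain ⟨ι', hι'⟩ := hS.2.2.1 e
      refine ⟨addEventAssign t X ι' σ, addEvent_predBot hι'.1 σ, fun e' he' => ?_⟩
      obtain ⟨e'', rfl, h'⟩ := addEvent_evLE_lift he'
      exact addEvent_locPred_some hO (hι'.2 e'' h') σ
  · have hinj : Function.Injective (Multiset.map fun bv : O.Place × Var =>
        ((Sum.inl bv.1 : O.Place ⊕ {pv // pv ∈ N.postFlow t}), bv.2)) := by
      refine Multiset.map_injective ?_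
      rintro ⟨b, v⟩ ⟨b', v'⟩ heq
      simpa using heq
    rintro (_ | e) (_ | e') h1 h2
    · rfl
    · exact (hnew e' (hinj h1).symm h2.symm).elim
    · exact (hnew e (hinj h1) h2).elim
    · exact congrArg some (hS.2.2.2 e e' (hinj h1) h2)

end AddEvent

/-- Maximality of the unfolding: it contains every possible extension of its finite
configurations. -/
theorem IsUnfolding.exists_event (hN : N.Safe) {h : Hom O N} (hU : IsUnfolding h)
    {t : N.Trans} {X : Multiset (O.Place × Var)}
    (hXt : X.map (fun bv => (h.mapP bv.1, bv.2)) = N.preFlow t)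
    {C : Set O.Trans} (hC : O.IsConfig C) {ι : O.Assign} (hι : O.IsInst C ι)
    (hX : ∀ bv ∈ X, bv.1 ∈ O.cut C) (hXn : (X.map Prod.fst).Nodup)
    (ht : ((N.postFlow t).map Prod.fst).Nodup) {σ : Var → Color}
    (hg : N.guard t σ) (hσ : ∀ bv ∈ X, σ bv.2 = O.valOf ι bv.1) :
    ∃ e, O.preFlow e = X ∧ h.mapT e = t := by
  by_contra! hnew
  obtain ⟨φ, hφ, -, -, hP, hT⟩ := hU.2 _ _ (addEvent_isSBP hU.1 hXt hC hι hX hXn ht hg hσ hnew)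
  let ψ : Hom O O :=
    { mapP := fun b => φ.mapP (Sum.inl b)
      mapT := fun e => φ.mapT (some e)
      guard_iff := fun e σ => φ.guard_iff (some e) σ
      pre_eq := fun e => by rw [φ.pre_eq (some e)]; simp [addEvent, Multiset.map_map]
      post_eq := fun e => by rw [φ.post_eq (some e)]; simp [addEvent, Multiset.map_map] }
  have hψ : ψ.Initial := by
    unfold Hom.Initial at hφ ⊢
    conv_rhs => rw [← hφ]
    simp only [addEvent, Set.image_image]
    refine Set.image_congr' fun K => ?_
    simp [Hom.mapMarking, Multiset.map_map, ψ]
  have hid := (hN.endomorphism_eq_id hU.1 ψ hψ (fun b => hP (Sum.inl b)) fun e => hT (some e)).1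
  refine hnew (φ.mapT none) ?_ (hT none)
  rw [φ.pre_eq none]
  simp only [addEvent, Option.elim_none, Multiset.map_map]
  conv_rhs => rw [← Multiset.map_id X]
  exact Multiset.map_congr rfl fun bv _ => Prod.ext (hid bv.1) rfl

theorem exists_multiset_map_eq {α β : Type*} {f : β → α} {P : β → Prop} {s : Multiset α}
    (hs : ∀ a ∈ s, ∃ b, P b ∧ f b = a) : ∃ u : Multiset β, u.map f = s ∧ ∀ b ∈ u, P b := by
  induction s using Multiset.induction_on with
  | empty => exact ⟨0, by simp⟩
  | cons a s ih =>
    obtain ⟨u, hu, hP⟩ := ih fun a' ha' => hs a' (Multiset.mem_cons_of_mem ha')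
    obtain ⟨b, hb, rfl⟩ := hs a (Multiset.mem_cons_self a s)
    refine ⟨b ::ₘ u, by rw [Multiset.map_cons, hu], fun b' hb' => ?_⟩
    rcases Multiset.mem_cons.1 hb' with rfl | hb'
    exacts [hb, hP b' hb']

theorem Safe.postFlow_nodup (hN : N.Safe) {M : N.Marking} (hM : N.Reach M) {t : N.Trans}
    {σ : Var → Color} (hf : N.fires M t σ) : ((N.postFlow t).map Prod.fst).Nodup := by
  have h := hN.nodup (hM.step ⟨hf, rfl⟩)
  rw [Multiset.map_add] at h
  have h' := (Multiset.nodup_add.1 h).2.1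
  rwa [postMark, Multiset.map_map] at h'

theorem Safe.preFlow_nodup (hN : N.Safe) {M : N.Marking} (hM : N.Reach M) {t : N.Trans}
    {σ : Var → Color} (hf : N.fires M t σ) : ((N.preFlow t).map Prod.fst).Nodup := by
  have h := Multiset.nodup_of_le (Multiset.map_le_map hf.2 (f := Prod.fst)) (hN.nodup hM)
  rwa [preMark, Multiset.map_map] at h

/-- In a safe net, a transition with empty preset that can fire has an empty postset. -/
theorem Safe.postFlow_eq_zero (hN : N.Safe) {M : N.Marking} (hM : N.Reach M) {t : N.Trans}
    {σ : Var → Color} (hf : N.fires M t σ) (ht : N.preFlow t = 0) : N.postFlow t = 0 := by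
  have hpre : N.preMark t σ = 0 := by rw [preMark, ht, Multiset.map_zero]
  have h := hN.nodup ((hM.step ⟨hf, rfl⟩).step ⟨⟨hf.1, by simp [hpre]⟩, rfl⟩)
  rw [hpre, tsub_zero, tsub_zero, Multiset.map_add, Multiset.map_add] at h
  have h' := (Multiset.nodup_add.1 h).2.2
  by_contra hne
  obtain ⟨a, ha⟩ := Multiset.exists_mem_of_ne_zero hne
  have hmem : a.1 ∈ (N.postMark t σ).map Prod.fst := by
    rw [postMark, Multiset.map_map]
    exact Multiset.mem_map_of_mem _ ha
  exact Multiset.disjoint_left.1 h' (Multiset.mem_add.2 (Or.inr hmem)) hmem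

/-- Every firing from the marking of an instantiated finite configuration of the unfolding
is represented by an event enabled at its cut. -/
theorem IsUnfolding.exists_enabled (hN : N.Safe) {h : Hom O N} (hU : IsUnfolding h)
    {C : Set O.Trans} (hC : O.FinCfg C) {ι : O.Assign} (hι : O.IsInst C ι)
    {hfin : (O.cut C).Finite} {t : N.Trans} {σ : Var → Color}
    (hf : N.fires (mark h hfin ι) t σ) :
    ∃ e, h.mapT e = t ∧ O.Enabled C e ∧ O.guard e σ ∧
      ∀ bv ∈ O.preFlow e, σ bv.2 = O.valOf ι bv.1 := by
  have hM := hC.1.reach hU.1.1 hU.1.2.1 hC.2 hι hfin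
  have hpre := hN.preFlow_nodup hM hf
  obtain ⟨X, hX, hXC⟩ := exists_multiset_map_eq (s := N.preFlow t)
    (f := fun bv : O.Place × Var => (h.mapP bv.1, bv.2))
    (P := fun bv => bv.1 ∈ O.cut C ∧ σ bv.2 = O.valOf ι bv.1) (by
      rintro ⟨p, v⟩ hpv
      have hmem : (p, σ v) ∈ mark h hfin ι :=
        Multiset.mem_of_le hf.2 (Multiset.mem_map.2 ⟨(p, v), hpv, rfl⟩)
      obtain ⟨b, hb, hbp⟩ := Multiset.mem_map.1 hmem
      obtain ⟨rfl, hv⟩ := Prod.mk.inj hbp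
      exact ⟨(b, v), ⟨hfin.mem_toFinset.1 hb, hv.symm⟩, rfl⟩)
  have hXn : (X.map Prod.fst).Nodup := by
    rw [← hX, Multiset.map_map] at hpre
    refine Multiset.Nodup.of_map h.mapP ?_
    rwa [Multiset.map_map]
  obtain ⟨e, he, het⟩ := hU.exists_event hN hX hC.1 hι (fun bv hbv => (hXC bv hbv).1) hXn
    (hN.postFlow_nodup hM hf) hf.1 fun bv hbv => (hXC bv hbv).2
  subst het
  exact ⟨e, rfl, fun b v hbv => (hXC (b, v) (he ▸ hbv)).1, (h.guard_iff e σ).2 hf.1,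
    fun bv hbv => (hXC bv (he ▸ hbv)).2⟩

/-- An event enabled at the cut of a configuration can fire there in a compatible mode. -/
theorem Enabled.fires_cutMark (hO : O.IsOccNet) {C : Set O.Trans} {e : O.Trans}
    (hen : O.Enabled C e) (hfin : (O.cut C).Finite) {ι : O.Assign} {σ : Var → Color}
    (hg : O.guard e σ) (hσ : ∀ bv ∈ O.preFlow e, σ bv.2 = O.valOf ι bv.1) :
    O.fires (O.cutMark hfin ι) e σ := by
  refine ⟨hg, ?_⟩
  have := Multiset.map_le_map (f := fun b => (b, O.valOf ι b)) (hen.preFlow_le hO hfin)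
  rw [Multiset.map_map] at this
  refine le_of_eq_of_le (Multiset.map_congr rfl fun bv hbv => ?_) this
  exact Prod.ext rfl (hσ bv hbv)

theorem Assign.setMode_inl (ι : O.Assign) (e : O.Trans) (σ : Var → Color) :
    (fun v => Assign.setMode ι e σ (Sum.inl (e, v))) = σ := by
  funext v
  simp [Assign.setMode]

/-- Extending an instantiated configuration by an enabled event fired in a compatible mode. -/
theorem IsConfig.insert_setMode (hO : O.IsOccNet) (h : Hom O N) {C : Set O.Trans}
    (hC : O.IsConfig C) {ι : O.Assign} (hι : O.IsInst C ι) {e : O.Trans} (he : e ∉ C)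
    (hen : O.Enabled C e) {σ : Var → Color} (hg : O.guard e σ)
    (hσ : ∀ bv ∈ O.preFlow e, σ bv.2 = O.valOf ι bv.1)
    (hfin : (O.cut C).Finite) (hfin' : (O.cut (insert e C)).Finite) :
    O.IsConfig (insert e C) ∧ O.IsInst (insert e C) (Assign.setMode ι e σ) ∧
      N.firesTo (mark h hfin ι) (h.mapT e) σ (mark h hfin' (Assign.setMode ι e σ)) := by
  have hag := agreeOn_setMode he ι σ
  have hloc : O.locPred e (Assign.setMode ι e σ) := by
    refine ⟨by rwa [Assign.setMode_inl], fun bv hbv => ?_⟩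
    rw [congrFun (Assign.setMode_inl ι e σ) bv.2, hσ bv hbv]
    exact hag.valOf_eq (hen bv.1 bv.2 hbv).1 hO
  obtain ⟨h1, h2⟩ := hC.insert_event hO (hag.isInst hO hC.1 hι) hen hloc
  refine ⟨h1, h2, ?_⟩
  have := hen.firesTo_mark hO h hC.1 he hloc hfin hfin'
  rwa [Assign.setMode_inl, ← hag.mark_eq hO h hfin] at this

/-- Every reachable marking is represented by a finite configuration of the unfolding. -/
theorem IsUnfolding.exists_finCfg (hN : N.Safe) {h : Hom O N} (hU : IsUnfolding h)
    {M : N.Marking} (hM : N.Reach M) : ∃ C, O.FinCfg C ∧ M ∈ marks h C := by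
  have hO := hU.1.1
  induction hM with
  | @init M hM =>
    rw [← hU.1.2.1] at hM
    obtain ⟨K, hK, rfl⟩ := hM
    obtain ⟨ι, hι, hKι⟩ := hU.1.exists_isInst_empty hK
    refine ⟨∅, ⟨⟨by simp, by simp, ι, hι⟩, Set.finite_empty⟩, ι, hι,
      hO.cut_finite Set.finite_empty, ?_⟩
    rw [mark_eq_mapMarking]
    exact congrArg _ (hO.eq_cutMark_empty hK hKι _)
  | @step M t σ M' hM hf ih =>
    obtain ⟨C, hC, ι, hι, hfin, rfl⟩ := ih
    by_cases ht : N.preFlow t = 0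
    · refine ⟨C, hC, ι, hι, hfin, ?_⟩
      rw [hf.2, preMark, postMark, ht, hN.postFlow_eq_zero hM hf.1 ht]
      simp
    · obtain ⟨e, rfl, hen, hg, hσ⟩ := hU.exists_enabled hN hC hι hf.1
      have he : e ∉ C := hen.notMem fun h0 => ht (by rw [h.pre_eq, h0, Multiset.map_zero])
      have hfin' := hO.cut_finite (hC.2.insert e)
      obtain ⟨h1, h2, h3⟩ := hC.1.insert_setMode hO h hι he hen hg hσ hfin hfin'
      exact ⟨insert e C, ⟨h1, hC.2.insert e⟩, _, h2, hfin', hf.2.trans h3.2.symm⟩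

theorem multiset_eq_of_map_eq {α β : Type*} {F : α → β} {A : Set α} (hF : Set.InjOn F A)
    {s u : Multiset α} (hs : ∀ a ∈ s, a ∈ A) (hu : ∀ a ∈ u, a ∈ A) (h : s.map F = u.map F) :
    s = u := by
  rcases isEmpty_or_nonempty α with hα | hα
  · exact Subsingleton.elim _ _
  · have key : ∀ w : Multiset α, (∀ a ∈ w, a ∈ A) → (w.map F).map (Function.invFunOn F A) = w := by
      intro w hw
      rw [Multiset.map_map]
      conv_rhs => rw [← Multiset.map_id w]
      exact Multiset.map_congr rfl fun a ha => hF.leftInvOn_invFunOn (hw a ha)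
    rw [← key s hs, ← key u hu, h]

theorem eq_of_map_mapP_eq {F : O.Place → N.Place} {A : Set O.Place} (hF : Set.InjOn F A)
    {s u : Multiset (O.Place × Var)} (hs : ∀ bv ∈ s, bv.1 ∈ A) (hu : ∀ bv ∈ u, bv.1 ∈ A)
    (h : s.map (fun bv => (F bv.1, bv.2)) = u.map fun bv => (F bv.1, bv.2)) : s = u := by
  refine multiset_eq_of_map_eq (A := {bv : O.Place × Var | bv.1 ∈ A}) ?_ hs hu h
  rintro ⟨b, v⟩ hb ⟨b', v'⟩ hb' heq
  obtain ⟨h1, rfl⟩ := Prod.mk.inj heq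
  exact Prod.ext (hF hb hb' h1) rfl

theorem cut_subset_cut_union_postConds {C₁ C : Set O.Trans} (hsub : C₁ ⊆ C) :
    O.cut C ⊆ O.cut C₁ ∪ O.postConds (C \ C₁) := by
  rintro b ⟨hb, hb'⟩
  have hpre : b ∉ O.preConds C₁ := fun ⟨e, he, hv⟩ => hb' ⟨e, hsub he, hv⟩
  rcases hb with hb | ⟨e, he, hv⟩
  · exact Or.inl ⟨Or.inl hb, hpre⟩
  · by_cases he' : e ∈ C₁
    · exact Or.inl ⟨Or.inr ⟨e, he', hv⟩, hpre⟩
    · exact Or.inr ⟨e, ⟨he, he'⟩, hv⟩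

theorem IsConfig.preConds_subset {C₁ C : Set O.Trans} (hC : O.IsConfig C) (hsub : C₁ ⊆ C) :
    O.preConds (C \ C₁) ⊆ O.cut C₁ ∪ O.postConds (C \ C₁) := by
  rintro b ⟨d, hd, v, hb⟩
  have hpre : b ∉ O.preConds C₁ := fun ⟨e, he, v', hv⟩ =>
    hd.2 (hC.eq_of_shared_pre hd.1 (hsub he) hb hv ▸ he)
  rcases O.mem_B0_or_exists_post b with h0 | ⟨e, v', hv⟩
  · exact Or.inl ⟨Or.inl h0, hpre⟩
  · by_cases he' : e ∈ C₁
    · exact Or.inl ⟨Or.inr ⟨e, he', v', hv⟩, hpre⟩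
    · exact Or.inr ⟨e, ⟨hC.1 d hd.1 e (evLE_of_post_pre hv hb), he'⟩, v', hv⟩

/-- The maps `f` on conditions and `g` on events transfer the suffix `C \ C₁` of the
configuration `C` to the suffix `C' \ C₂` of the configuration `C'`. -/
structure Transfer (h : Hom O N) (C₁ C C₂ C' : Set O.Trans) (ι ι' : O.Assign)
    (f : O.Place → O.Place) (g : O.Trans → O.Trans) : Prop where
  image_eq : C' = C₂ ∪ g '' (C \ C₁)
  finCfg : O.FinCfg C'
  isInst : O.IsInst C' ι'
  mark_eq : ∀ (hfin : (O.cut C).Finite) (hfin' : (O.cut C').Finite),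
    mark h hfin' ι' = mark h hfin ι
  mark_eq_start : ∀ (hfin : (O.cut C₁).Finite) (hfin' : (O.cut C₂).Finite),
    mark h hfin' ι' = mark h hfin ι
  notMem : ∀ d ∈ C \ C₁, g d ∉ C₂
  injOn_trans : Set.InjOn g (C \ C₁)
  pre_eq : ∀ d ∈ C \ C₁, O.preFlow (g d) = (O.preFlow d).map fun bv => (f bv.1, bv.2)
  post_eq : ∀ d ∈ C \ C₁, O.postFlow (g d) = (O.postFlow d).map fun bv => (f bv.1, bv.2)
  mapT_eq : ∀ d ∈ C \ C₁, h.mapT (g d) = h.mapT d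
  injOn_place : Set.InjOn f (O.cut C₁ ∪ O.postConds (C \ C₁))
  mapP_eq : ∀ b ∈ O.cut C₁ ∪ O.postConds (C \ C₁), h.mapP (f b) = h.mapP b
  image_cut : f '' O.cut C₁ = O.cut C₂

theorem Transfer.mem_image {h : Hom O N} {C₁ C C₂ C' : Set O.Trans} {ι ι' : O.Assign}
    {f : O.Place → O.Place} {g : O.Trans → O.Trans} (hT : Transfer h C₁ C C₂ C' ι ι' f g)
    {d : O.Trans} (hd : d ∈ C \ C₁) : g d ∈ C' \ C₂ :=
  ⟨hT.image_eq ▸ Or.inr ⟨d, hd, rfl⟩, hT.notMem d hd⟩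

theorem Transfer.sdiff_eq {h : Hom O N} {C₁ C C₂ C' : Set O.Trans} {ι ι' : O.Assign}
    {f : O.Place → O.Place} {g : O.Trans → O.Trans} (hT : Transfer h C₁ C C₂ C' ι ι' f g) :
    C' \ C₂ = g '' (C \ C₁) := by
  refine Set.Subset.antisymm ?_ (Set.image_subset_iff.2 fun d hd => hT.mem_image hd)
  rintro e ⟨he, he'⟩
  rw [hT.image_eq] at he
  exact he.resolve_left he'

theorem Transfer.image_places {h : Hom O N} {C₁ C C₂ C' : Set O.Trans} {ι ι' : O.Assign}
    {f : O.Place → O.Place} {g : O.Trans → O.Trans} (hT : Transfer h C₁ C C₂ C' ι ι' f g) :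
    f '' (O.cut C₁ ∪ O.postConds (C \ C₁)) = O.cut C₂ ∪ O.postConds (C' \ C₂) := by
  rw [Set.image_union, hT.image_cut]
  congr 1
  ext b
  constructor
  · rintro ⟨b, ⟨d, hd, v, hv⟩, rfl⟩
    refine ⟨g d, hT.mem_image hd, v, ?_⟩
    rw [hT.post_eq d hd]
    exact Multiset.mem_map.2 ⟨(b, v), hv, rfl⟩
  · rintro ⟨e, he, v, hv⟩
    rw [hT.sdiff_eq] at he
    obtain ⟨d, hd, rfl⟩ := he
    rw [hT.post_eq d hd] at hv
    obtain ⟨⟨b', v'⟩, hb', heq⟩ := Multiset.mem_map.1 hv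
    exact ⟨b', ⟨d, hd, v', hb'⟩, congrArg Prod.fst heq⟩

theorem notMem_preConds_of_mem {C C' : Set O.Trans} (hC : ∀ e ∈ C, ∀ e', O.evLE e' e → e' ∈ C)
    {b : O.Place} (hb : b ∈ O.cut C ∪ O.postConds (C' \ C)) : b ∉ O.preConds C := by
  rcases hb with hb | ⟨d, hd, v, hv⟩
  · exact hb.2
  · rintro ⟨e, he, v', hv'⟩
    exact hd.2 (hC e he d (evLE_of_post_pre hv hv'))

theorem Transfer.mapsTo_cut {h : Hom O N} {C₁ C C₂ C' : Set O.Trans} {ι ι' : O.Assign}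
    {f : O.Place → O.Place} {g : O.Trans → O.Trans} (hT : Transfer h C₁ C C₂ C' ι ι' f g)
    (hsub : C₁ ⊆ C) (hC : O.IsConfig C) (hC₂ : ∀ e ∈ C₂, ∀ e', O.evLE e' e → e' ∈ C₂) :
    Set.MapsTo f (O.cut C) (O.cut C') := by
  intro b hb
  have hbA := cut_subset_cut_union_postConds hsub hb
  have hfb : f b ∈ O.cut C₂ ∪ O.postConds (C' \ C₂) :=
    hT.image_places ▸ Set.mem_image_of_mem f hbA
  have hC₂' : C₂ ⊆ C' := hT.image_eq ▸ Set.subset_union_left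
  refine ⟨?_, ?_⟩
  · rcases hfb with ⟨h0 | ⟨e, he, hv⟩, -⟩ | ⟨e, he, hv⟩
    exacts [Or.inl h0, Or.inr ⟨e, hC₂' he, hv⟩, Or.inr ⟨e, he.1, hv⟩]
  · rintro ⟨e, he, v, hv⟩
    by_cases he₂ : e ∈ C₂
    · exact notMem_preConds_of_mem hC₂ hfb ⟨e, he₂, v, hv⟩
    · have he' : e ∈ C' \ C₂ := ⟨he, he₂⟩
      rw [hT.sdiff_eq] at he'
      obtain ⟨d, hd, rfl⟩ := he'
      rw [hT.pre_eq d hd] at hv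
      obtain ⟨⟨b', v'⟩, hb', heq⟩ := Multiset.mem_map.1 hv
      have := hT.injOn_place (hC.preConds_subset hsub ⟨d, hd, v', hb'⟩) hbA
        (congrArg Prod.fst heq)
      exact hb.2 ⟨d, hd.1, v', this ▸ hb'⟩

theorem exists_transfer_refl (hN : N.Safe) {h : Hom O N} (hS : IsSBP h) {C₁ C₂ : Set O.Trans}
    (hC₁ : O.FinCfg C₁) (hC₂ : O.FinCfg C₂) {ι ι₂ : O.Assign} (hι₂ : O.IsInst C₂ ι₂)
    {hfin₁ : (O.cut C₁).Finite} {hfin₂ : (O.cut C₂).Finite}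
    (hM : mark h hfin₂ ι₂ = mark h hfin₁ ι) :
    ∃ f, Transfer h C₁ C₁ C₂ C₂ ι ι₂ f id := by
  have hinj₁ := hN.injOn_cut hS.1 hS.2.1 hC₁.1 hC₁.2
  have hinj₂ := hN.injOn_cut hS.1 hS.2.1 hC₂.1 hC₂.2
  have hex : ∀ b : O.Place, ∃ b', b ∈ O.cut C₁ → b' ∈ O.cut C₂ ∧ h.mapP b' = h.mapP b := by
    intro b
    by_cases hb : b ∈ O.cut C₁
    · have : (h.mapP b, O.valOf ι b) ∈ mark h hfin₁ ι :=
        Multiset.mem_map.2 ⟨b, hfin₁.mem_toFinset.2 hb, rfl⟩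
      rw [← hM] at this
      obtain ⟨b', hb', heq⟩ := Multiset.mem_map.1 this
      exact ⟨b', fun _ => ⟨hfin₂.mem_toFinset.1 hb', congrArg Prod.fst heq⟩⟩
    · exact ⟨b, fun hb' => (hb hb').elim⟩
  choose f hf using hex
  have hD : C₁ \ C₁ = ∅ := Set.sdiff_self
  have hpost : O.postConds (C₁ \ C₁) = ∅ := by
    rw [hD]
    exact Set.eq_empty_of_forall_notMem fun b ⟨e, he, _⟩ => he
  refine ⟨f, ⟨by simp, hC₂, hι₂, fun _ _ => hM, fun _ _ => hM, by simp, by simp, by simp,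
    by simp, by simp, ?_, ?_, ?_⟩⟩
  · rw [hpost, Set.union_empty]
    intro b hb b' hb' heq
    refine hinj₁ hb hb' ?_
    rw [← (hf b hb).2, heq, (hf b' hb').2]
  · rw [hpost, Set.union_empty]
    exact fun b hb => (hf b hb).2
  · refine Set.Subset.antisymm (Set.image_subset_iff.2 fun b hb => (hf b hb).1) fun b' hb' => ?_
    have : (h.mapP b', O.valOf ι₂ b') ∈ mark h hfin₂ ι₂ :=
      Multiset.mem_map.2 ⟨b', hfin₂.mem_toFinset.2 hb', rfl⟩
    rw [hM] at this
    obtain ⟨b, hb, heq⟩ := Multiset.mem_map.1 this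
    have hb := hfin₁.mem_toFinset.1 hb
    exact ⟨b, hb, hinj₂ (hf b hb).1 hb' ((hf b hb).2.trans (congrArg Prod.fst heq))⟩

theorem Transfer.exists_insert (hN : N.Safe) {h : Hom O N} (hU : IsUnfolding h)
    {C₁ C C₂ C' : Set O.Trans} {ι ι' : O.Assign} {f : O.Place → O.Place} {g : O.Trans → O.Trans}
    (hT : Transfer h C₁ C C₂ C' ι ι' f g) (hsub : C₁ ⊆ C) (hC : O.FinCfg C)
    (hC₂ : O.FinCfg C₂) {e : O.Trans}
    (he : e ∉ C) (hen : O.Enabled C e) (hloc : O.locPred e ι) (hne : O.preFlow e ≠ 0) :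
    ∃ f' g' C'' ι'', Transfer h C₁ (insert e C) C₂ C'' ι ι'' f' g' := by
  have hO := hU.1.1
  have hfin := hO.cut_finite hC.2
  have hfin' := hO.cut_finite hT.finCfg.2
  have hfinE := hO.cut_finite (hC.2.insert e)
  have hfire := hen.firesTo_mark hO h hC.1.1 he hloc hfin hfinE
  rw [← hT.mark_eq hfin hfin'] at hfire
  obtain ⟨e', hee', hen', hg', hσ'⟩ := hU.exists_enabled hN hT.finCfg hT.isInst hfire.1
  have hNpre : N.preFlow (h.mapT e) ≠ 0 := by
    rw [h.pre_eq]
    exact fun h0 => hne (Multiset.map_eq_zero.1 h0)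
  have he' : e' ∉ C' := hen'.notMem fun h0 => hNpre (by
    rw [← hee', h.pre_eq, h0, Multiset.map_zero])
  have hfinE' := hO.cut_finite (hT.finCfg.2.insert e')
  obtain ⟨hcfg, hinst, hfire'⟩ := hT.finCfg.1.insert_setMode hO h hT.isInst he' hen' hg' hσ'
    hfin' hfinE'
  have he₁ : e ∉ C₁ := fun h0 => he (hsub h0)
  have hD : insert e C \ C₁ = insert e (C \ C₁) := Set.insert_sdiff_of_notMem _ he₁
  have hpost : O.postConds (insert e C \ C₁) =
      {b | ∃ v, (b, v) ∈ O.postFlow e} ∪ O.postConds (C \ C₁) := by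
    rw [hD]
    ext b
    simp [postConds, Set.mem_ofPred_eq]
  have hcutA := cut_subset_cut_union_postConds (O := O) hsub
  have hC₂' : C₂ ⊆ C' := by
    rw [hT.image_eq]
    exact Set.subset_union_left
  have hgD : ∀ d ∈ C \ C₁, g d ∈ C' := fun d hd => by
    rw [hT.image_eq]
    exact Or.inr ⟨d, hd, rfl⟩
  have hpre : O.preFlow e' = (O.preFlow e).map fun bv => (f bv.1, bv.2) := by
    refine eq_of_map_mapP_eq (hN.injOn_cut hO hU.1.2.1 hT.finCfg.1 hT.finCfg.2)
      (fun bv hbv => hen' bv.1 bv.2 hbv) ?_ ?_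
    · rintro bv hbv
      obtain ⟨bv', hbv', rfl⟩ := Multiset.mem_map.1 hbv
      exact hT.mapsTo_cut hsub hC.1 hC₂.1.1 (hen bv'.1 bv'.2 hbv')
    · rw [← h.pre_eq, hee', h.pre_eq, Multiset.map_map]
      exact Multiset.map_congr rfl fun bv hbv =>
        Prod.ext (hT.mapP_eq _ (hcutA (hen bv.1 bv.2 hbv))).symm rfl
  have hex : ∀ b : O.Place, ∃ b', ((∃ v, (b, v) ∈ O.postFlow e) →
      (∃ v, (b', v) ∈ O.postFlow e') ∧ h.mapP b' = h.mapP b) ∧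
      ((¬ ∃ v, (b, v) ∈ O.postFlow e) → b' = f b) := by
    intro b
    by_cases hb : ∃ v, (b, v) ∈ O.postFlow e
    · obtain ⟨v, hv⟩ := hb
      have hmem : (h.mapP b, v) ∈ N.postFlow (h.mapT e) := by
        rw [h.post_eq]
        exact Multiset.mem_map.2 ⟨(b, v), hv, rfl⟩
      rw [← hee', h.post_eq] at hmem
      obtain ⟨⟨b', v'⟩, hb', heq⟩ := Multiset.mem_map.1 hmem
      exact ⟨b', fun _ => ⟨⟨v', hb'⟩, congrArg Prod.fst heq⟩, fun h0 => (h0 ⟨v, hv⟩).elim⟩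
    · exact ⟨f b, fun h0 => (hb h0).elim, fun _ => rfl⟩
  choose f' hf'post hf'old using hex
  have hf'A : ∀ b ∈ O.cut C₁ ∪ O.postConds (C \ C₁), f' b = f b := by
    rintro b hb
    refine hf'old b ?_
    rintro ⟨v, hv⟩
    rcases hb with hb | ⟨d, hd, v', hv'⟩
    · exact notMem_cut_of_mem_post hO he₁ hv hb
    · obtain ⟨rfl, -⟩ := hO.post_unique hv hv'
      exact he hd.1
  have hpost' : O.postFlow e' = (O.postFlow e).map fun bv => (f' bv.1, bv.2) := by
    refine eq_of_map_mapP_eq (hN.injOn_post hU.1 e') (fun bv hbv => ⟨bv.2, hbv⟩) ?_ ?_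
    · rintro bv hbv
      obtain ⟨bv', hbv', rfl⟩ := Multiset.mem_map.1 hbv
      exact (hf'post bv'.1 ⟨bv'.2, hbv'⟩).1
    · rw [← h.post_eq, hee', h.post_eq, Multiset.map_map]
      exact Multiset.map_congr rfl fun bv hbv =>
        Prod.ext (hf'post bv.1 ⟨bv.2, hbv⟩).2.symm rfl
  have hg'D : ∀ d ∈ C \ C₁, Function.update g e e' d = g d := fun d hd =>
    Function.update_of_ne (fun h0 : d = e => he (h0 ▸ hd.1)) _ _
  have himg : Function.update g e e' '' (C \ C₁) = g '' (C \ C₁) := Set.image_congr hg'D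
  have hcross : ∀ b b₁, (∃ v, (b, v) ∈ O.postFlow e) →
      b₁ ∈ O.cut C₁ ∪ O.postConds (C \ C₁) → f' b ≠ f' b₁ := by
    intro b b₁ hb hb₁ heq
    rw [hf'A b₁ hb₁] at heq
    obtain ⟨⟨v, hv⟩, -⟩ := hf'post b hb
    rw [heq] at hv
    rcases hb₁ with hb₁ | ⟨d, hd, v', hv'⟩
    · refine notMem_cut_of_mem_post hO (fun h0 => he' (hC₂' h0)) hv ?_
      rw [← hT.image_cut]
      exact ⟨b₁, hb₁, rfl⟩
    · have : (f b₁, v') ∈ O.postFlow (g d) := by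
        rw [hT.post_eq d hd]
        exact Multiset.mem_map.2 ⟨(b₁, v'), hv', rfl⟩
      obtain ⟨h0, -⟩ := hO.post_unique hv this
      exact he' (h0 ▸ hgD d hd)
  refine ⟨f', Function.update g e e', insert e' C', _, ⟨?_, ⟨hcfg, hT.finCfg.2.insert e'⟩, hinst,
    fun _ _ => hfire'.2.trans ?_, ?_, ?_, ?_, ?_, ?_, ?_, ?_, ?_, ?_⟩⟩
  · rw [hD, Set.image_insert_eq, himg, Function.update_self, Set.union_insert, ← hT.image_eq]
  · rw [hee', hfire.2]
  · intro hfin₁ hfin₂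
    rw [← hT.mark_eq_start hfin₁ hfin₂]
    exact ((agreeOn_setMode (fun h0 => he' (hC₂' h0)) ι' _).mark_eq hO h hfin₂).symm
  · rw [hD]
    rintro d (rfl | hd)
    · rw [Function.update_self]
      exact fun h0 => he' (hC₂' h0)
    · rw [hg'D d hd]
      exact hT.notMem d hd
  · rw [hD]
    refine (Set.injOn_insert fun h0 => he h0.1).2 ⟨hT.injOn_trans.congr fun d hd => (hg'D d hd).symm, ?_⟩
    rw [himg, Function.update_self]
    rintro ⟨d, hd, hdd⟩
    exact he' (hdd ▸ hgD d hd)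
  · rw [hD]
    rintro d (rfl | hd)
    · rw [Function.update_self, hpre]
      exact Multiset.map_congr rfl fun bv hbv =>
        Prod.ext (hf'A _ (hcutA (hen bv.1 bv.2 hbv))).symm rfl
    · rw [hg'D d hd, hT.pre_eq d hd]
      exact Multiset.map_congr rfl fun bv hbv =>
        Prod.ext (hf'A _ (hC.1.preConds_subset hsub ⟨d, hd, bv.2, hbv⟩)).symm rfl
  · rw [hD]
    rintro d (rfl | hd)
    · rw [Function.update_self, hpost']
    · rw [hg'D d hd, hT.post_eq d hd]
      exact Multiset.map_congr rfl fun bv hbv =>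
        Prod.ext (hf'A _ (Or.inr ⟨d, hd, bv.2, hbv⟩)).symm rfl
  · rw [hD]
    rintro d (rfl | hd)
    · rw [Function.update_self, hee']
    · rw [hg'D d hd, hT.mapT_eq d hd]
  · rw [hpost, Set.union_left_comm]
    rintro b (hb | hb) b₁ (hb₁ | hb₁) heq
    · refine hN.injOn_post hU.1 e hb hb₁ ?_
      rw [← (hf'post b hb).2, heq, (hf'post b₁ hb₁).2]
    · exact (hcross b b₁ hb hb₁ heq).elim
    · exact (hcross b₁ b hb₁ hb heq.symm).elim
    · rw [hf'A b hb, hf'A b₁ hb₁] at heq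
      exact hT.injOn_place hb hb₁ heq
  · rw [hpost, Set.union_left_comm]
    rintro b (hb | hb)
    · exact (hf'post b hb).2
    · rw [hf'A b hb, hT.mapP_eq b hb]
  · rw [← hT.image_cut]
    exact Set.image_congr fun b hb => hf'A b (Or.inl hb)

/-- Configurations with a common marking have the same extensions. -/
theorem exists_transfer (hN : N.Safe) {h : Hom O N} (hU : IsUnfolding h)
    {C₁ C C₂ : Set O.Trans} (hC₁ : O.FinCfg C₁) (hC : O.FinCfg C) (hsub : C₁ ⊆ C)
    (hC₂ : O.FinCfg C₂) (hne : ∀ e ∈ C, O.preFlow e ≠ 0) {ι ι₂ : O.Assign}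
    (hι : O.IsInst C ι) (hι₂ : O.IsInst C₂ ι₂)
    {hfin₁ : (O.cut C₁).Finite} {hfin₂ : (O.cut C₂).Finite}
    (hM : mark h hfin₂ ι₂ = mark h hfin₁ ι) :
    ∃ f g C' ι', Transfer h C₁ C C₂ C' ι ι' f g := by
  refine hC.1.induction hU.1.1 (P := fun C => ∃ f g C' ι', Transfer h C₁ C C₂ C' ι ι' f g)
    hC₁.1.1 hsub hC.2 ?_ ?_
  · obtain ⟨f, hf⟩ := exists_transfer_refl hN hU.1 hC₁ hC₂ hι₂ hM
    exact ⟨f, id, C₂, ι₂, hf⟩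
  · rintro C₀ e h1 h2 he hen hins ⟨f, g, C', ι', hT⟩
    have heC := hins (Set.mem_insert e C₀)
    exact hT.exists_insert hN hU h1 ⟨h2, hC.2.subset ((Set.subset_insert e C₀).trans hins)⟩ hC₂ he hen
      (hι.locPred heC) (hne e heC)

theorem exists_leftInvOn {α : Type*} {f : α → α} {s : Set α} (hf : Set.InjOn f s) :
    ∃ f', Set.LeftInvOn f' f s := by
  rcases isEmpty_or_nonempty α with hα | hα
  · exact ⟨f, fun a => (hα.false a).elim⟩
  · exact ⟨_, hf.leftInvOn_invFunOn⟩

theorem injOn_image_of_leftInvOn {α β : Type*} {f : α → β} {f' : β → α} {s : Set α}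
    (hf : Set.LeftInvOn f' f s) : Set.InjOn f' (f '' s) := by
  rintro _ ⟨a, ha, rfl⟩ _ ⟨b, hb, rfl⟩ heq
  rw [hf ha, hf hb] at heq
  rw [heq]

theorem Transfer.symm {h : Hom O N} {C₁ C C₂ C' : Set O.Trans} {ι ι' : O.Assign}
    {f : O.Place → O.Place} {g : O.Trans → O.Trans} (hT : Transfer h C₁ C C₂ C' ι ι' f g)
    (hsub : C₁ ⊆ C) (hC : O.FinCfg C) (hι : O.IsInst C ι) {f' : O.Place → O.Place}
    {g' : O.Trans → O.Trans}
    (hf' : Set.LeftInvOn f' f (O.cut C₁ ∪ O.postConds (C \ C₁)))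
    (hg' : Set.LeftInvOn g' g (C \ C₁)) : Transfer h C₂ C' C₁ C ι' ι f' g' := by
  have himg : g' '' (C' \ C₂) = C \ C₁ := by rw [hT.sdiff_eq, hg'.image_image]
  refine ⟨?_, hC, hι, fun _ _ => (hT.mark_eq _ _).symm, fun _ _ => (hT.mark_eq_start _ _).symm,
    ?_, ?_, ?_, ?_, ?_, ?_, ?_, ?_⟩
  · rw [himg, Set.union_sdiff_cancel hsub]
  · intro e he
    exact (himg ▸ Set.mem_image_of_mem g' he : g' e ∈ C \ C₁).2
  · rw [hT.sdiff_eq]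
    exact injOn_image_of_leftInvOn hg'
  · rw [hT.sdiff_eq]
    rintro _ ⟨d, hd, rfl⟩
    rw [hg' hd, hT.pre_eq d hd, Multiset.map_map]
    conv_lhs => rw [← Multiset.map_id (O.preFlow d)]
    exact Multiset.map_congr rfl fun bv hbv =>
      Prod.ext (hf' (hC.1.preConds_subset hsub ⟨d, hd, bv.2, hbv⟩)).symm rfl
  · rw [hT.sdiff_eq]
    rintro _ ⟨d, hd, rfl⟩
    rw [hg' hd, hT.post_eq d hd, Multiset.map_map]
    conv_lhs => rw [← Multiset.map_id (O.postFlow d)]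
    exact Multiset.map_congr rfl fun bv hbv =>
      Prod.ext (hf' (Or.inr ⟨d, hd, bv.2, hbv⟩)).symm rfl
  · rw [hT.sdiff_eq]
    rintro _ ⟨d, hd, rfl⟩
    rw [hg' hd, hT.mapT_eq d hd]
  · rw [← hT.image_places]
    exact injOn_image_of_leftInvOn hf'
  · rw [← hT.image_places]
    rintro _ ⟨b, hb, rfl⟩
    rw [hf' hb, hT.mapP_eq b hb]
  · rw [← hT.image_cut]
    exact (hf'.mono Set.subset_union_left).image_image

theorem futureEvents_of_mem {C C' : Set O.Trans} (hC' : O.IsConfig C') (hsub : C ⊆ C')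
    {ι : O.Assign} (hι : O.IsInst C' ι) {e : O.Trans} (he : e ∈ C' \ C) :
    e ∈ O.futureEvents C :=
  ⟨he.2, fun e' he' => hC'.2.1 e' (hsub he') e he.1, ι, isInst_mono hsub hι, hι.2 e he.1⟩

theorem futurePlaces_of_mem (hO : O.IsOccNet) {C C' : Set O.Trans} (hC' : O.IsConfig C')
    (hC : ∀ e ∈ C, ∀ e', O.evLE e' e → e' ∈ C) (hsub : C ⊆ C') {ι : O.Assign}
    (hι : O.IsInst C' ι) {b : O.Place} (hb : b ∈ O.cut C ∪ O.postConds (C' \ C)) :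
    b ∈ O.futurePlaces C := by
  have hpost : ∀ e v, (b, v) ∈ O.postFlow e → e ∈ C' := by
    intro e v hv
    rcases hb with ⟨h0 | ⟨e', he', v', hv'⟩, -⟩ | ⟨e', he', v', hv'⟩
    · exact (notMem_B0_of_mem hv h0).elim
    · exact (hO.post_unique hv hv').1 ▸ hsub he'
    · exact (hO.post_unique hv hv').1 ▸ he'.1
  refine ⟨notMem_preConds_of_mem hC hb, ?_, ι, isInst_mono hsub hι, ?_⟩
  · rintro e' he' ⟨b₀, t₁, t₂, hne, ⟨v₁, h₁⟩, ⟨v₂, h₂⟩, h₃, h₄⟩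
    obtain ⟨e'', v, hv, hle⟩ := exists_post_of_cle h₄
    exact hne (hC'.eq_of_shared_pre (hsub (hC _ he' _ h₃)) (hC'.1 _ (hpost _ _ hv) _ hle) h₁ h₂)
  · change O.condPred b ι
    unfold condPred
    cases hcp : O.condPre b with
    | none => exact hι.1
    | some ev => exact hι.2 _ (hpost _ _ (mem_postFlow_of_condPre hcp))

/-- A transfer of suffixes induces a canonical monomorphism between the futures. -/
theorem Transfer.exists_canonMono (hO : O.IsOccNet) {h : Hom O N} {C₁ C C₂ C' : Set O.Trans}
    {ι ι' : O.Assign} {f : O.Place → O.Place} {g : O.Trans → O.Trans}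
    (hT : Transfer h C₁ C C₂ C' ι ι' f g) (hsub : C₁ ⊆ C) (hC : O.FinCfg C)
    (hC₂ : O.FinCfg C₂) :
    ∃ φ : Hom (O.around C₁ (C \ C₁)) (O.future C₂), IsCanonMono h C₁ (C \ C₁) C₂ φ ∧
      monoImageD C₁ (C \ C₁) C₂ φ = C' \ C₂ := by
  have hC₂' : C₂ ⊆ C' := hT.image_eq ▸ Set.subset_union_left
  have hAr : O.aroundPlaces C₁ (C \ C₁) ⊆ O.cut C₁ ∪ O.postConds (C \ C₁) :=
    Set.union_subset (Set.union_subset Set.subset_union_left (hC.1.preConds_subset hsub))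
      Set.subset_union_right
  have hfP : ∀ b ∈ O.cut C₁ ∪ O.postConds (C \ C₁), f b ∈ O.futurePlaces C₂ := fun b hb =>
    futurePlaces_of_mem hO hT.finCfg.1 hC₂.1.1 hC₂' hT.isInst
      (hT.image_places ▸ Set.mem_image_of_mem f hb)
  let mP : (O.around C₁ (C \ C₁)).Place → (O.future C₂).Place := fun b => ⟨f b.1, hfP _ (hAr b.2)⟩
  let mT : (O.around C₁ (C \ C₁)).Trans → (O.future C₂).Trans := fun d =>
    ⟨g d.1, futureEvents_of_mem hT.finCfg.1 hC₂' hT.isInst (hT.mem_image d.2)⟩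
  have hflow : ∀ {s : Multiset (O.Place × Var)} {u : Multiset (O.Place × Var)},
      (∀ bv ∈ s, bv.1 ∈ O.aroundPlaces C₁ (C \ C₁)) → u = s.map (fun bv => (f bv.1, bv.2)) →
      u.filterMap (fun bv => if hb : bv.1 ∈ O.futurePlaces C₂ then
        some ((⟨bv.1, hb⟩ : O.futurePlaces C₂), bv.2) else none) =
      (s.filterMap (fun bv => if hb : bv.1 ∈ O.aroundPlaces C₁ (C \ C₁) then
        some ((⟨bv.1, hb⟩ : O.aroundPlaces C₁ (C \ C₁)), bv.2) else none)).map
        fun bv => (mP bv.1, bv.2) := by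
    rintro s _ hs rfl
    induction s using Multiset.induction_on with
    | empty => rfl
    | cons bv s ih =>
      have hbv := hs bv (Multiset.mem_cons_self bv s)
      rw [Multiset.map_cons, Multiset.filterMap_cons_some _ _ _ (dif_pos (hfP _ (hAr hbv))),
        Multiset.filterMap_cons_some _ _ _ (dif_pos hbv), Multiset.map_cons,
        ih fun bv' hbv' => hs bv' (Multiset.mem_cons_of_mem hbv')]
      rfl
  let φ : Hom (O.around C₁ (C \ C₁)) (O.future C₂) :=
    { mapP := mP
      mapT := mT
      guard_iff := fun d σ => by
        change O.guard d.1 σ ↔ O.guard (g d.1) σ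
        rw [h.guard_iff, h.guard_iff, hT.mapT_eq d.1 d.2]
      pre_eq := fun d => hflow (fun bv hbv => Or.inl (Or.inr ⟨d.1, d.2, bv.2, hbv⟩))
        (hT.pre_eq d.1 d.2)
      post_eq := fun d => hflow (fun bv hbv => Or.inr ⟨d.1, d.2, bv.2, hbv⟩)
        (hT.post_eq d.1 d.2) }
  refine ⟨φ, ⟨?_, ?_, fun b => hT.mapP_eq b.1 (hAr b.2), fun d => hT.mapT_eq d.1 d.2, ?_⟩, ?_⟩
  · intro b b' hbb
    exact Subtype.ext (hT.injOn_place (hAr b.2) (hAr b'.2) (congrArg Subtype.val hbb))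
  · intro d d' hdd
    exact Subtype.ext (hT.injOn_trans d.2 d'.2 (congrArg Subtype.val hdd))
  · rw [← hT.image_cut]
    ext b
    constructor
    · rintro ⟨b', hb', rfl⟩
      exact ⟨b'.1, hb', rfl⟩
    · rintro ⟨b', hb', rfl⟩
      exact ⟨⟨b', Or.inl (Or.inl hb')⟩, hb', rfl⟩
  · rw [hT.sdiff_eq]
    ext e
    constructor
    · rintro ⟨d, rfl⟩
      exact ⟨d.1, d.2, rfl⟩
    · rintro ⟨d, hd, rfl⟩
      exact ⟨⟨d, hd⟩, rfl⟩

/-- In the unfolding of a safe net, events with empty preset have empty postset. -/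
theorem Safe.event_postFlow_eq_zero (hN : N.Safe) {h : Hom O N} (hS : IsSBP h) {e : O.Trans}
    (he : O.preFlow e = 0) : O.postFlow e = 0 := by
  have hO := hS.1
  obtain ⟨ι, hι⟩ := hS.2.2.1 e
  have hcone := hS.isConfig_cone e
  have hι' : O.IsInst (O.cone e) ι := ⟨hι.1, fun e' he' =>
    ⟨hι.1, fun e'' he'' => hι.2 e'' (evLE_trans he'' he')⟩⟩
  have hcfg := hcone.diff_singleton (e := e) fun e' he' hle => hO.evLE_antisymm he' hle
  have hfinC := (hO.cone_finite e).subset (Set.sdiff_subset (t := {e}))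
  have hfin := hO.cut_finite hfinC
  have hM := hcfg.reach hO hS.2.1 hfinC (isInst_mono Set.sdiff_subset hι') hfin
  have hfire := (hcone.enabled_diff_singleton hO (evLE_refl e)).firesTo_mark hO h hcfg.1
    (fun h0 => h0.2 rfl) (hι.2 e (evLE_refl e)) hfin (hO.cut_finite (hfinC.insert e))
  have := hN.postFlow_eq_zero hM hfire.1 (by rw [h.pre_eq, he, Multiset.map_zero])
  rw [h.post_eq] at this
  exact Multiset.map_eq_zero.1 this

/-- Events with empty preset can be removed from a configuration without changing its
markings. -/
theorem Safe.mem_marks_sdiff (hN : N.Safe) {h : Hom O N} (hS : IsSBP h) {C : Set O.Trans}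
    (hC : O.FinCfg C) {e : O.Trans} (heC : e ∈ C) (he : O.preFlow e = 0) {M : N.Marking}
    (hM : M ∈ marks h C) : O.FinCfg (C \ {e}) ∧ M ∈ marks h (C \ {e}) := by
  have hO := hS.1
  obtain ⟨ι, hι, hfin, rfl⟩ := hM
  have hpost := hN.event_postFlow_eq_zero hS he
  have hcfg := hC.1.diff_singleton (e := e) fun e' _ hle => by
    rcases Relation.ReflTransGen.cases_head hle with heq | ⟨y, hy, -⟩
    · exact (Sum.inr.inj heq).symm
    · rcases y with b | e''
      · obtain ⟨v, hv⟩ := hy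
        simp [hpost] at hv
      · exact hy.elim
  have hfinC := hC.2.subset (Set.sdiff_subset (t := {e}))
  have hins : insert e (C \ {e}) = C := Set.insert_sdiff_self_of_mem heC
  have hfin' := hO.cut_finite hfinC
  refine ⟨⟨hcfg, hfinC⟩, ι, isInst_mono Set.sdiff_subset hι, hfin', ?_⟩
  have hfire := (hC.1.enabled_diff_singleton hO heC).firesTo_mark hO h hcfg.1
    (fun h0 => h0.2 rfl) (hι.locPred heC) hfin' (hO.cut_finite (hfinC.insert e))
  simp only [hins] at hfire
  rw [hfire.2, preMark, postMark, h.pre_eq, h.post_eq, he, hpost]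
  simp

/-- A configuration without events of empty preset that contains a cut-off event is not
minimal among the finite configurations representing one of its markings. -/
theorem IsAdequate.exists_lt_of_isCutoff (hN : N.Safe) {h : Hom O N} (hU : IsUnfolding h)
    {r : Set O.Trans → Set O.Trans → Prop} (hr : IsAdequate h r) {C : Set O.Trans}
    (hC : O.FinCfg C) (hne : ∀ e ∈ C, O.preFlow e ≠ 0) {M : N.Marking} (hM : M ∈ marks h C)
    {e : O.Trans} (heC : e ∈ C) (hcut : IsCutoff h r e) :
    ∃ C', O.FinCfg C' ∧ M ∈ marks h C' ∧ r C' C := by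
  have hO := hU.1.1
  obtain ⟨ι, hι, hfin, rfl⟩ := hM
  have hsub : O.cone e ⊆ C := fun e' he' => hC.1.1 e heC e' he'
  have hcone : ∀ e, O.FinCfg (O.cone e) := fun e => ⟨hU.1.isConfig_cone e, hO.cone_finite e⟩
  have hfin₁ := hO.cut_finite (hcone e).2
  have hM₁ : mark h hfin₁ ι ∈ marks h (O.cone e) := ⟨ι, isInst_mono hsub hι, hfin₁, rfl⟩
  obtain ⟨e', hre, hM₂⟩ := hcut _ hM₁
  obtain ⟨ι₂, hι₂, hfin₂, heq⟩ := id hM₂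
  obtain ⟨f, g, C', ι', hT⟩ :=
    exists_transfer hN hU (hcone e) hC hsub (hcone e') hne hι hι₂ heq.symm
  obtain ⟨f', hf'⟩ := exists_leftInvOn hT.injOn_place
  obtain ⟨g', hg'⟩ := exists_leftInvOn hT.injOn_trans
  have hsub' : O.cone e' ⊆ C' := hT.image_eq ▸ Set.subset_union_left
  obtain ⟨φ, hφ, hφD⟩ := (hT.symm hsub hC hι hf' hg').exists_canonMono hO hsub' hT.finCfg (hcone e)
  have hun : O.cone e' ∪ C' \ O.cone e' = C' := Set.union_sdiff_cancel hsub'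
  have hlt := hr.2.2.2.2 _ _ (C' \ O.cone e') _ (hcone e') (hcone e)
    ⟨Set.disjoint_sdiff_right, hun.symm ▸ hT.finCfg.1⟩ (hT.finCfg.2.subset Set.sdiff_subset)
    hM₂ hM₁ ⟨ι', hun.symm ▸ hT.isInst, hfin₂, hT.mark_eq_start hfin₁ hfin₂⟩ φ hφ hre
  rw [hun, hφD, Set.union_sdiff_cancel hsub] at hlt
  have hfin' := hO.cut_finite hT.finCfg.2
  exact ⟨C', hT.finCfg, ⟨ι', hT.isInst, hfin', (hT.mark_eq hfin hfin').symm⟩, hlt⟩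

end HLNet

/-- Let `N` be a high-level Petri net in the class `Nf`, let `≺` be an
adequate order on the finite configurations of its symbolic unfolding `Υ = (O, h)`,
and let `Fin` be the prefix of `Υ` consisting of all events `e` such that the cone `[e]`
contains no cut-off event of `Υ` other than possibly `e` itself, together with all
conditions in `B0` and in the postsets of these events. Then `Fin` is a complete
prefix of `Υ`. -/
theorem fin_prefix_is_complete {Color Var : Type} (N O : HLNet Color Var)
    (h : HLNet.Hom O N) (hNf : N.InNf) (hU : HLNet.IsUnfolding h)
    (r : Set O.Trans → Set O.Trans → Prop) (hr : HLNet.IsAdequate h r) :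
    HLNet.CompleteSub h (HLNet.finEvents h r) := by
  have hN := hNf.2.2.1
  have hO := hU.1.1
  intro M hM
  obtain ⟨C₀, hC₀, hMC₀⟩ := hU.exists_finCfg hN hM
  obtain ⟨⟨C, hC⟩, hMC, hmin⟩ :=
    hr.2.2.1.has_min {C | M ∈ HLNet.marks h C.1} ⟨⟨C₀, hC₀⟩, hMC₀⟩
  have hne : ∀ e ∈ C, O.preFlow e ≠ 0 := by
    intro e he h0
    obtain ⟨hC', hMC'⟩ := hN.mem_marks_sdiff hU.1 hC he h0 hMC
    exact hmin ⟨_, hC'⟩ hMC' (hr.2.2.2.1 _ _ hC' hC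
      ⟨Set.sdiff_subset, fun hsub => (hsub he).2 rfl⟩)
  have hcut : ∀ e ∈ C, ¬ HLNet.IsCutoff h r e := by
    intro e he hce
    obtain ⟨C', hC', hMC', hlt⟩ := hr.exists_lt_of_isCutoff hN hU hC hne hMC he hce
    exact hmin ⟨C', hC'⟩ hMC' hlt
  obtain ⟨ι, hι, hfin, rfl⟩ := hMC
  refine ⟨C, hC.1, fun e he e' he' _ => hcut e' (hC.1.1 e he e' he'), ι, hι, hfin, rfl,
    fun t σ hf => ?_⟩
  obtain ⟨e, rfl, hen, hg, hσ⟩ := hU.exists_enabled hN hC hι hf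
  exact ⟨e, fun e' he' hne' => hcut e' ((hen.mem_of_evLE hO hC.1.1 he').resolve_left hne'), rfl,
    hen.fires_cutMark hO hfin hg hσ⟩
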